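/- arXiv:math/0604118 — 3 statements merged into one kernel-verified Lean document; each statement's English description precedes it below -/
import Mathlib

section
/- Let n, m ≥ 1 and r ≥ 0 be integers and C ≥ 1. There is a constant K > 0, depending only on n, r and C, with the following property. Let D₀, D₁ ⊆ ℂ^m be bounded open sets with D_{0,1} := D₀∩D₁ nonempty, let P ⊆ ℂ^n be a bounded open set, let δ > 0, and let c ∈ A^{r,0}(D_{0,1}×P)^n, a ∈ A^{r,0}(D₀×P)^n, b ∈ A^{r,0}(D₁×P)^n satisfy: c(z,t) = b(z,t) − a(z,t) on D̄_{0,1}×P, ‖a‖_{C^{r,0}(D₀×P)} ≤ C·‖c‖_{C^{r,0}(D_{0,1}×P)}, ‖b‖_{C^{r,0}(D₁×P)} ≤ C·‖c‖_{C^{r,0}(D_{0,1}×P)}, and 4·√n·C·‖c‖_{C^{r,0}(D_{0,1}×P)} < δ. Then there exists c̃ ∈ A^{r,0}(D_{0,1}×P_{−δ})^n such that for all (z,t) ∈ D̄_{0,1}×P_{−δ}: t + a(z,t) ∈ P, t + c̃(z,t) ∈ P, and (with α(z,t) := t+a(z,t), β(z,t) := t+b(z,t), γ(z,t) := t+c(z,t))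 γ(z, α(z,t)) = β(z, t + c̃(z,t)); moreover ‖c̃‖_{C^{r,0}(D_{0,1}×P_{−δ})} ≤ K·‖c‖²_{C^{r,0}(D_{0,1}×P)}/δ. If in addition all partial derivatives in t of order < m₀ of a, b and c vanish at t = 0, then the same holds for c̃. -/
open Set Filter Complex Metric

noncomputable section

abbrev Cn (N : ℕ) := EuclideanSpace ℂ (Fin N)

/-- The mixed partial derivative of order `i` in `z ∈ ℂ^m` and `j` in `t ∈ ℂ^n`. -/
def pder {m n : ℕ} {F : Type*} [NormedAddCommGroup F] [NormedSpace ℂ F]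
    (i j : ℕ) (f : Cn m × Cn n → F) (p : Cn m × Cn n) :
    ContinuousMultilinearMap ℂ (fun _ : Fin i => Cn m)
      (ContinuousMultilinearMap ℂ (fun _ : Fin j => Cn n) F) :=
  iteratedFDeriv ℂ i (fun z => iteratedFDeriv ℂ j (fun t => f (z, t)) p.2) p.1

/-- `f` is of class `A^{r,s}(D×P)`. -/
def ClassArs {m n : ℕ} {F : Type*} [NormedAddCommGroup F] [NormedSpace ℂ F]
    (r s : ℕ) (D : Set (Cn m)) (P : Set (Cn n)) (f : Cn m × Cn n → F) : Prop :=
  ContinuousOn f (closure D ×ˢ P) ∧ DifferentiableOn ℂ f (D ×ˢ P) ∧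
  ∀ i ≤ r, ∀ j ≤ s, ∃ g : Cn m × Cn n → ContinuousMultilinearMap ℂ (fun _ : Fin i => Cn m)
      (ContinuousMultilinearMap ℂ (fun _ : Fin j => Cn n) F),
    ContinuousOn g (closure D ×ˢ P) ∧ EqOn g (pder i j f) (D ×ˢ P) ∧
    ∃ C : ℝ, ∀ p ∈ closure D ×ˢ P, ‖g p‖ ≤ C

/-- The `C^{r,s}(D×P)` norm. -/
def normCrs {m n : ℕ} {F : Type*} [NormedAddCommGroup F] [NormedSpace ℂ F]
    (r s : ℕ) (D : Set (Cn m)) (P : Set (Cn n)) (f : Cn m × Cn n → F) : ℝ :=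
  sSup {x : ℝ | ∃ i ≤ r, ∃ j ≤ s, ∃ p ∈ D ×ˢ P, x = ‖pder i j f p‖}

/-- `P_{-δ}`. -/
def shrink {n : ℕ} (P : Set (Cn n)) (δ : ℝ) : Set (Cn n) := {t ∈ P | ball t δ ⊆ P}

/-- All partial derivatives in `t` of order `< m₀` vanish at `t = 0`. -/
def TVanish {m n : ℕ} {F : Type*} [NormedAddCommGroup F] [NormedSpace ℂ F]
    (m₀ : ℕ) (D : Set (Cn m)) (f : Cn m × Cn n → F) : Prop :=
  ∀ j < m₀, ∀ z ∈ D, iteratedFDeriv ℂ j (fun t => f (z, t)) 0 = 0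



section SCV

variable {E F : Type} [NormedAddCommGroup E] [NormedSpace ℂ E]
  [NormedAddCommGroup F] [NormedSpace ℂ F]

theorem scv_line {f : E → F} {x h : E} {l : ℂ} (hf : DifferentiableAt ℂ f (x + l • h)) :
    HasDerivAt (fun l : ℂ => f (x + l • h)) (fderiv ℂ f (x + l • h) h) l := by
  have h1 : HasDerivAt (fun l : ℂ => x + l • h) h l := by
    have := ((hasDerivAt_id l).smul_const h).const_add x
    simpa using this
  exact hf.hasFDerivAt.comp_hasDerivAt l h1

theorem scv_cauchy_one {f : E → F} {x : E} {ρ M : ℝ} (hρ : 0 < ρ)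
    (hf : DifferentiableOn ℂ f (ball x ρ)) (hM : ∀ y ∈ ball x ρ, ‖f y‖ ≤ M) :
    ‖fderiv ℂ f x‖ ≤ M / ρ := by
  have hM0 : 0 ≤ M := (norm_nonneg _).trans (hM x (mem_ball_self hρ))
  refine ContinuousLinearMap.opNorm_le_bound _ (by positivity) fun h => ?_
  rcases eq_or_ne h 0 with rfl | hh
  · simp
  have hh' : 0 < ‖h‖ := norm_pos_iff.2 hh
  have key : ∀ ρ' < ρ, ‖fderiv ℂ f x h‖ * ρ' ≤ M * ‖h‖ := by
    intro ρ' hρ'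
    rcases le_or_gt ρ' 0 with h0 | h0
    · exact (mul_nonpos_of_nonneg_of_nonpos (norm_nonneg _) h0).trans (by positivity)
    have hR : 0 < ρ' / ‖h‖ := by positivity
    have hmem : ∀ l ∈ closedBall (0 : ℂ) (ρ' / ‖h‖), x + l • h ∈ ball x ρ := by
      intro l hl
      rw [mem_closedBall_zero_iff, le_div_iff₀ hh'] at hl
      simp only [mem_ball, dist_self_add_left, norm_smul]
      linarith
    have hd : ∀ l ∈ closedBall (0 : ℂ) (ρ' / ‖h‖),
        HasDerivAt (fun l : ℂ => f (x + l • h)) (fderiv ℂ f (x + l • h) h) l := fun l hl =>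
      scv_line ((hf _ (hmem l hl)).differentiableAt (isOpen_ball.mem_nhds (hmem l hl)))
    have hdc : DiffContOnCl ℂ (fun l : ℂ => f (x + l • h)) (ball 0 (ρ' / ‖h‖)) := by
      apply DifferentiableOn.diffContOnCl
      rw [closure_ball _ hR.ne']
      exact fun l hl => (hd l hl).differentiableAt.differentiableWithinAt
    have := Complex.norm_deriv_le_of_forall_mem_sphere_norm_le hR hdc
      (fun l hl => hM _ (hmem l (sphere_subset_closedBall hl)))
    rw [(hd 0 (mem_closedBall_self hR.le)).deriv] at this
    simp only [zero_smul, add_zero] at this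
    rw [le_div_iff₀ hR, ← mul_div_assoc, div_le_iff₀ hh'] at this
    exact this
  have : ‖fderiv ℂ f x h‖ * ρ ≤ M * ‖h‖ := by
    have hcont : Tendsto (fun ρ' : ℝ => ‖fderiv ℂ f x h‖ * ρ') (nhdsWithin ρ (Iio ρ))
        (nhds (‖fderiv ℂ f x h‖ * ρ)) := by
      apply Tendsto.mono_left _ nhdsWithin_le_nhds
      exact (continuous_const.mul continuous_id).tendsto _
    refine le_of_tendsto hcont ?_
    filter_upwards [self_mem_nhdsWithin] with ρ' h1 using key ρ' h1
  rw [div_mul_eq_mul_div, le_div_iff₀ hρ]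
  exact this

theorem scv_dir_diff [FiniteDimensional ℂ E] [FiniteDimensional ℂ F] {f : E → F} {U : Set E}
    (hU : IsOpen U) (hf : DifferentiableOn ℂ f U) (h : E) :
    DifferentiableOn ℂ (fun x => fderiv ℂ f x h) U := by
  intro x hx
  apply DifferentiableAt.differentiableWithinAt
  have : CompleteSpace F := FiniteDimensional.complete ℂ F
  have : ProperSpace E := FiniteDimensional.proper ℂ E
  have : ProperSpace (E →L[ℂ] F) := FiniteDimensional.proper ℂ _
  obtain ⟨ρ, hρ, hρU⟩ : ∃ ρ > 0, closedBall x ρ ⊆ U := nhds_basis_closedBall.mem_iff.1 (hU.mem_nhds hx)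
  obtain ⟨M, hM⟩ := (isCompact_closedBall x ρ).exists_bound_of_continuousOn
    (hf.continuousOn.mono hρU)
  obtain ⟨R, hR, hRh⟩ : ∃ R > 0, R * ‖h‖ < ρ / 4 := by
    refine ⟨ρ / 4 / (‖h‖ + 1), by positivity, ?_⟩
    rw [div_mul_eq_mul_div, div_lt_iff₀ (by positivity)]
    nlinarith [norm_nonneg h]
  have hmem : ∀ y ∈ ball x (ρ / 4), ∀ l ∈ closedBall (0 : ℂ) R, y + l • h ∈ ball x (ρ / 2) := by
    intro y hy l hl
    rw [mem_closedBall_zero_iff] at hl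
    rw [mem_ball, dist_eq_norm] at hy ⊢
    calc ‖y + l • h - x‖ = ‖(y - x) + l • h‖ := by congr 1; abel
      _ ≤ ‖y - x‖ + ‖l‖ * ‖h‖ := (norm_add_le _ _).trans (by rw [norm_smul])
      _ ≤ ‖y - x‖ + R * ‖h‖ := by gcongr
      _ < ρ / 2 := by linarith
  have hb2U : ball x (ρ / 2) ⊆ U := (ball_subset_closedBall.trans
    (closedBall_subset_closedBall (by linarith))).trans hρU
  have hdiffat : ∀ y ∈ U, DifferentiableAt ℂ f y := fun y hy => (hf y hy).differentiableAt (hU.mem_nhds hy)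
  have hfd : ∀ y ∈ ball x (ρ / 2), ‖fderiv ℂ f y‖ ≤ M / (ρ / 2) := by
    intro y hy
    have hsub : ball y (ρ / 2) ⊆ closedBall x ρ := by
      intro w hw
      rw [mem_ball] at hy hw
      rw [mem_closedBall]
      linarith [dist_triangle w y x]
    exact scv_cauchy_one (by positivity) (hf.mono (hsub.trans hρU)) (fun w hw => hM w (hsub hw))
  have hform : ∀ y ∈ ball x (ρ / 4), fderiv ℂ f y h =
      (2 * ↑Real.pi * Complex.I)⁻¹ • ∫ θ in (0 : ℝ)..2 * Real.pi,
        (deriv (circleMap 0 R) θ * ((circleMap 0 R θ) ^ 2)⁻¹) • f (y + circleMap 0 R θ • h) := by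
    intro y hy
    have hV : IsOpen ((fun l : ℂ => y + l • h) ⁻¹' U) := hU.preimage (by fun_prop)
    have h1 : DifferentiableOn ℂ (fun l : ℂ => f (y + l • h)) ((fun l : ℂ => y + l • h) ⁻¹' U) :=
      fun l hl => (scv_line (hdiffat _ hl)).differentiableAt.differentiableWithinAt
    have h2 := Complex.two_pi_I_inv_smul_circleIntegral_sub_sq_inv_smul_of_differentiable hV
      (c := 0) (w₀ := 0) (R := R) (fun l hl => hb2U (hmem y hy l hl)) h1 (mem_ball_self hR)
    have h3 : HasDerivAt (fun l : ℂ => f (y + l • h)) (fderiv ℂ f y h) 0 := by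
      have := scv_line (f := f) (x := y) (h := h) (l := 0) (hdiffat _ (by
        simpa using hb2U (hmem y hy 0 (mem_closedBall_self hR.le))))
      simpa using this
    rw [h3.deriv] at h2
    rw [← h2, circleIntegral]
    simp [mul_smul]
  have hcm : ∀ θ : ℝ, circleMap 0 R θ ∈ closedBall (0 : ℂ) R := fun θ =>
    circleMap_mem_closedBall 0 hR.le θ
  have hxb : x ∈ ball x (ρ / 4) := mem_ball_self (by positivity)
  set w : ℝ → ℂ := fun θ => deriv (circleMap 0 R) θ * ((circleMap 0 R θ) ^ 2)⁻¹ with hw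
  have hcmc : Continuous (circleMap 0 R) := continuous_circleMap 0 R
  have hwc : Continuous w := by
    have h1 : Continuous (fun θ => deriv (circleMap 0 R) θ) := by
      simp only [deriv_circleMap]
      fun_prop
    refine h1.mul (Continuous.inv₀ (by fun_prop) ?_)
    intro θ
    exact pow_ne_zero _ (circleMap_ne_center hR.ne')
  have hcont : ∀ y ∈ ball x (ρ / 4), Continuous (fun θ => w θ • f (y + circleMap 0 R θ • h)) := by
    intro y hy
    refine hwc.smul ?_
    rw [← continuousOn_univ]
    refine (hf.continuousOn).comp (by fun_prop) ?_
    intro θ _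
    exact hb2U (hmem y hy _ (hcm θ))
  have hder : HasFDerivAt (fun y => ∫ θ in (0 : ℝ)..2 * Real.pi, w θ • f (y + circleMap 0 R θ • h))
      (∫ θ in (0 : ℝ)..2 * Real.pi, w θ • fderiv ℂ f (x + circleMap 0 R θ • h)) x := by
    apply intervalIntegral.hasFDerivAt_integral_of_dominated_of_fderiv_le
      (F' := fun y θ => w θ • fderiv ℂ f (y + circleMap 0 R θ • h))
      (bound := fun θ => ‖w θ‖ * (M / (ρ / 2)))
      (ball_mem_nhds x (show 0 < ρ / 4 by positivity))
    · filter_upwards [ball_mem_nhds x (show 0 < ρ / 4 by positivity)] with y hy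
      exact (hcont y hy).aestronglyMeasurable
    · exact (hcont x hxb).intervalIntegrable _ _
    · borelize E
      borelize (E →L[ℂ] F)
      apply Measurable.aestronglyMeasurable
      apply Measurable.smul hwc.measurable
      have hc : Continuous (fun θ : ℝ => x + circleMap 0 R θ • h) := by fun_prop
      exact (measurable_fderiv ℂ f).comp hc.measurable
    · refine Eventually.of_forall fun θ _ y hy => ?_
      rw [norm_smul]
      gcongr
      exact hfd _ (hmem y hy _ (hcm θ))
    · exact (Continuous.mul (by fun_prop) continuous_const).intervalIntegrable _ _
    · refine Eventually.of_forall fun θ _ y hy => ?_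
      apply HasFDerivAt.const_smul
      have h0 := (hdiffat _ (hb2U (hmem y hy _ (hcm θ)))).hasFDerivAt
      have h2 := h0.comp y ((hasFDerivAt_id y).add_const (circleMap 0 R θ • h))
      simpa [Function.comp_def] using h2
  have hfin := hder.const_smul ((2 * ↑Real.pi * Complex.I)⁻¹ : ℂ)
  refine (hfin.congr_of_eventuallyEq ?_).differentiableAt
  filter_upwards [ball_mem_nhds x (show 0 < ρ / 4 by positivity)] with y hy
  exact hform y hy

theorem scv_contDiffOn_one [FiniteDimensional ℂ E] [FiniteDimensional ℂ F] {f : E → F} {U : Set E}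
    (hU : IsOpen U) (hf : DifferentiableOn ℂ f U) :
    DifferentiableOn ℂ (fderiv ℂ f) U := by
  intro x hx
  let b := Module.finBasis ℂ E
  have : CompleteSpace F := FiniteDimensional.complete ℂ F
  have hh : ContDiffOn ℂ 0 (fderiv ℂ f) U := by
    rw [contDiffOn_clm_apply]
    exact fun y => contDiffOn_zero.2 (scv_dir_diff hU hf y).continuousOn
  let Φ : (E →L[ℂ] F) ≃L[ℂ] (Fin (Module.finrank ℂ E) → F) :=
    LinearEquiv.toContinuousLinearEquiv
      (LinearMap.toContinuousLinearMap.symm.trans (b.constr ℂ).symm)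
  have h1 : DifferentiableWithinAt ℂ (fun x => Φ (fderiv ℂ f x)) U x := by
    rw [differentiableWithinAt_pi]
    intro i
    exact scv_dir_diff hU hf (b i) x hx
  have h2 := (Φ.symm.differentiable.differentiableAt (x := Φ (fderiv ℂ f x))).comp_differentiableWithinAt x h1
  simpa [Function.comp_def] using h2

theorem scv_contDiffOn_nat [FiniteDimensional ℂ E] (k : ℕ) : ∀ {G : Type}
    [NormedAddCommGroup G] [NormedSpace ℂ G] [FiniteDimensional ℂ G] {f : E → G} {U : Set E},
    IsOpen U → DifferentiableOn ℂ f U → ContDiffOn ℂ k f U := by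
  induction k with
  | zero => 
    intro G _ _ _ f U hU hf
    exact contDiffOn_zero.2 hf.continuousOn
  | succ k ih =>
    intro G _ _ _ f U hU hf
    push_cast
    rw [contDiffOn_succ_iff_fderiv_of_isOpen hU]
    refine ⟨hf, ?_, ih hU (scv_contDiffOn_one hU hf)⟩
    intro h
    exact absurd h (by simp)

theorem scv_iter_diff [FiniteDimensional ℂ E] [FiniteDimensional ℂ F] {f : E → F} {U : Set E}
    (hU : IsOpen U) (hf : DifferentiableOn ℂ f U) (i : ℕ) :
    DifferentiableOn ℂ (iteratedFDeriv ℂ i f) U := by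
  have h := scv_contDiffOn_nat (i + 1) hU hf
  have h2 := h.differentiableOn_iteratedFDerivWithin (m := i) (by norm_cast; omega) hU.uniqueDiffOn
  exact h2.congr fun x hx => (iteratedFDerivWithin_of_isOpen i hU hx).symm

/-- Cauchy constants. -/
def cauchyK (i : ℕ) : ℝ := Nat.rec 1 (fun k x => x * 2 ^ (k + 1)) i

theorem cauchyK_pos (i : ℕ) : 0 < cauchyK i := by
  induction i with
  | zero => simp [cauchyK]
  | succ k ih =>
    have : cauchyK (k + 1) = cauchyK k * 2 ^ (k + 1) := rfl
    rw [this]; positivity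

theorem scv_cauchy [FiniteDimensional ℂ E] [FiniteDimensional ℂ F] {f : E → F} {M : ℝ} (i : ℕ) :
    ∀ {x : E} {ρ : ℝ}, 0 < ρ →
    DifferentiableOn ℂ f (ball x ρ) → (∀ y ∈ ball x ρ, ‖f y‖ ≤ M) →
    ‖iteratedFDeriv ℂ i f x‖ ≤ cauchyK i * M / ρ ^ i := by
  induction i with
  | zero =>
    intro x ρ hρ hf hM
    simpa [cauchyK] using hM x (mem_ball_self hρ)
  | succ k ih =>
    intro x ρ hρ hf hM
    rw [← norm_fderiv_iteratedFDeriv]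
    have hsub : ∀ y ∈ ball x (ρ / 2), ball y (ρ / 2) ⊆ ball x ρ := by
      intro y hy
      apply ball_subset_ball'
      rw [mem_ball] at hy
      linarith
    have h1 := scv_cauchy_one (f := iteratedFDeriv ℂ k f) (x := x) (ρ := ρ / 2)
      (M := cauchyK k * M / (ρ / 2) ^ k) (by positivity)
      ((scv_iter_diff isOpen_ball hf k).mono (ball_subset_ball (by linarith)))
      (fun y hy => ih (by positivity) (hf.mono (hsub y hy)) (fun w hw => hM w (hsub y hy hw)))
    refine h1.trans (le_of_eq ?_)
    have : cauchyK (k + 1) = cauchyK k * 2 ^ (k + 1) := rfl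
    rw [this, div_pow]
    field_simp
    ring

theorem scv_vanish [FiniteDimensional ℂ E] [FiniteDimensional ℂ F] {f : E → F} {ρ B : ℝ} {k : ℕ}
    (hρ : 0 < ρ) (hf : DifferentiableOn ℂ f (ball 0 ρ))
    (hB : ∀ y ∈ ball 0 ρ, ‖f y‖ ≤ B * ‖y‖ ^ k) {j : ℕ} (hj : j < k) :
    iteratedFDeriv ℂ j f 0 = 0 := by
  have hB' : ∀ y ∈ ball 0 ρ, ‖f y‖ ≤ |B| * ‖y‖ ^ k := fun y hy =>
    (hB y hy).trans (by gcongr; exact le_abs_self B)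
  have key : ∀ e, 0 < e → e ≤ ρ → ‖iteratedFDeriv ℂ j f 0‖ ≤ cauchyK j * |B| * e ^ (k - j) := by
    intro e he heρ
    have := scv_cauchy (f := f) (M := |B| * e ^ k) j he (hf.mono (ball_subset_ball heρ)) (by
      intro y hy
      refine (hB' y (ball_subset_ball heρ hy)).trans ?_
      rw [mem_ball_zero_iff] at hy
      gcongr)
    refine this.trans (le_of_eq ?_)
    rw [show e ^ k = e ^ (k - j) * e ^ j by rw [← pow_add]; congr 1; omega]
    field_simp
  have ht : Tendsto (fun e : ℝ => cauchyK j * |B| * e ^ (k - j)) (nhdsWithin 0 (Ioi 0)) (nhds 0) := by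
    have : Continuous (fun e : ℝ => cauchyK j * |B| * e ^ (k - j)) := by fun_prop
    have h2 := this.tendsto 0
    rw [zero_pow (by omega), mul_zero] at h2
    exact h2.mono_left nhdsWithin_le_nhds
  have := ge_of_tendsto ht (b := ‖iteratedFDeriv ℂ j f 0‖) (by
    filter_upwards [Ioc_mem_nhdsGT hρ] with e he using key e he.1 he.2)
  exact norm_eq_zero.1 (le_antisymm this (norm_nonneg _))

theorem taylor_aux {B : ℝ} (k : ℕ) : ∀ (u : ℕ → ℝ → F),
    (∀ i ≤ k, ∀ x ∈ Icc (0:ℝ) 1, HasDerivWithinAt (u i) (u (i + 1) x) (Icc 0 1) x) →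
    (∀ x ∈ Icc (0:ℝ) 1, ‖u (k + 1) x‖ ≤ B) → ∀ x ∈ Icc (0:ℝ) 1,
    ‖u 0 x - ∑ i ∈ Finset.range (k + 1), ((i.factorial : ℝ)⁻¹ * x ^ i) • u i 0‖ ≤ B := by
  induction k with
  | zero =>
    intro u hu hB x hx
    have hB0 : 0 ≤ B := (norm_nonneg _).trans (hB 0 (by simp))
    have := norm_image_sub_le_of_norm_deriv_le_segment' (f := u 0) (f' := u 1) (a := 0) (b := 1)
      (hu 0 le_rfl) (fun y hy => hB y ⟨hy.1, hy.2.le⟩) x hx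
    simp only [zero_add, Finset.range_one, Finset.sum_singleton, Nat.factorial_zero, Nat.cast_one, inv_one, pow_zero,
      mul_one, one_smul]
    refine this.trans ?_
    nlinarith [hx.1, hx.2]
  | succ k ih =>
    intro u hu hB x hx
    have hB0 : 0 ≤ B := (norm_nonneg _).trans (hB 0 (by simp))
    have h1 := ih (fun i => u (i + 1)) (fun i hi => hu (i + 1) (by omega)) hB
    have hd : ∀ y ∈ Icc (0:ℝ) 1, HasDerivWithinAt
        (fun x => u 0 x - ∑ i ∈ Finset.range (k + 1 + 1), ((i.factorial : ℝ)⁻¹ * x ^ i) • u i 0)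
        (u 1 y - ∑ i ∈ Finset.range (k + 1), ((i.factorial : ℝ)⁻¹ * y ^ i) • u (i + 1) 0) (Icc 0 1) y := by
      intro y hy
      refine (hu 0 (by omega) y hy).sub ?_
      have hs : ∀ i ∈ Finset.range (k + 1 + 1), HasDerivWithinAt (fun x : ℝ => ((i.factorial : ℝ)⁻¹ * x ^ i) • u i 0)
          (((i.factorial : ℝ)⁻¹ * (i * y ^ (i - 1))) • u i 0) (Icc 0 1) y := by
        intro i _
        exact (((hasDerivAt_pow i y).const_mul _).smul_const _).hasDerivWithinAt
      have h3 := HasDerivWithinAt.fun_sum hs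
      convert h3 using 1
      rw [Finset.sum_range_succ' _ (k + 1)]
      simp only [Nat.factorial_zero, Nat.cast_zero, zero_mul, mul_zero, zero_smul, add_zero]
      refine Finset.sum_congr rfl fun i _ => ?_
      congr 1
      rw [Nat.factorial_succ, Nat.add_sub_cancel]
      push_cast
      have : ((i:ℝ) + 1) ≠ 0 := by positivity
      have : ((i.factorial:ℝ)) ≠ 0 := by positivity
      field_simp
    have := norm_image_sub_le_of_norm_deriv_le_segment' (a := 0) (b := 1)
      hd (fun y hy => h1 y ⟨hy.1, hy.2.le⟩) x hx
    have h0 : u 0 0 - ∑ i ∈ Finset.range (k + 1 + 1), ((i.factorial : ℝ)⁻¹ * (0:ℝ) ^ i) • u i 0 = 0 := by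
      rw [Finset.sum_range_succ' _ (k + 1)]
      simp
    rw [h0, sub_zero] at this
    refine this.trans ?_
    nlinarith [hx.1, hx.2]

theorem scv_taylor [FiniteDimensional ℂ E] [FiniteDimensional ℂ F] {f : E → F} {x : E} {ρ M : ℝ}
    (hρ : 0 < ρ) (hf : DifferentiableOn ℂ f (ball x (2 * ρ))) (hM : ∀ y ∈ ball x (2 * ρ), ‖f y‖ ≤ M)
    (k : ℕ) {h : E} (hh : ‖h‖ < ρ) :
    ‖f (x + h) - ∑ i ∈ Finset.range (k + 1), ((i.factorial : ℂ)⁻¹) • iteratedFDeriv ℂ i f x (fun _ => h)‖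
      ≤ cauchyK (k + 1) * M / ρ ^ (k + 1) * ‖h‖ ^ (k + 1) := by
  have hmem : ∀ l ∈ Icc (0:ℝ) 1, x + (l : ℂ) • h ∈ ball x ρ := by
    intro l hl
    simp only [mem_ball, dist_self_add_left, norm_smul, Complex.norm_real, Real.norm_eq_abs, abs_of_nonneg hl.1]
    nlinarith [hl.1, hl.2, norm_nonneg h]
  have hbd : ∀ y ∈ ball x ρ, ‖iteratedFDeriv ℂ (k + 1) f y‖ ≤ cauchyK (k + 1) * M / ρ ^ (k + 1) := by
    intro y hy
    have hsub : ball y ρ ⊆ ball x (2 * ρ) := by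
      apply ball_subset_ball'
      rw [mem_ball] at hy
      linarith
    exact scv_cauchy _ hρ (hf.mono hsub) (fun w hw => hM w (hsub hw))
  have := taylor_aux (B := cauchyK (k + 1) * M / ρ ^ (k + 1) * ‖h‖ ^ (k + 1)) k
    (fun i l => iteratedFDeriv ℂ i f (x + (l : ℂ) • h) (fun _ => h)) ?_ ?_ 1 (by simp)
  · have he : ∀ (q : ℕ) (v : F), ((q : ℂ)⁻¹) • v = ((q : ℝ)⁻¹) • v := by
      intro q v
      rw [← Complex.coe_smul]
      simp
    simpa [he] using this
  · intro i _ l hl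
    have hm : x + (l : ℂ) • h ∈ ball x (2 * ρ) := ball_subset_ball (by linarith) (hmem l hl)
    have hd := ((scv_iter_diff isOpen_ball hf i) _ hm).differentiableAt (isOpen_ball.mem_nhds hm)
    have h1 := scv_line hd
    have h2 := HasDerivAt.scomp l h1 Complex.ofRealCLM.hasDerivAt
    simp only [Complex.ofRealCLM_apply, Complex.ofReal_one, one_smul] at h2
    have h3 := ((ContinuousMultilinearMap.apply ℂ (fun _ : Fin i => E) F (fun _ => h)).restrictScalars ℝ).hasFDerivAt.comp_hasDerivAt l h2
    refine HasDerivAt.hasDerivWithinAt ?_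
    convert h3 using 1
    · rfl
    · rw [iteratedFDeriv_succ_apply_left]
      rfl
  · intro l hl
    refine (ContinuousMultilinearMap.le_opNorm _ _).trans ?_
    simp only [Finset.prod_const, Finset.card_univ, Fintype.card_fin]
    gcongr
    exact hbd _ (hmem l hl)

end SCV

section Slices

variable {E T F : Type} [NormedAddCommGroup E] [NormedSpace ℂ E] [FiniteDimensional ℂ E]
  [NormedAddCommGroup T] [NormedSpace ℂ T] [FiniteDimensional ℂ T]
  [NormedAddCommGroup F] [NormedSpace ℂ F] [FiniteDimensional ℂ F]

theorem slice_eq {f : E × T → F} {D : Set E} {P : Set T} (hD : IsOpen D) (hP : IsOpen P)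
    (hf : DifferentiableOn ℂ f (D ×ˢ P)) (i : ℕ) {z : E} {t : T} (hz : z ∈ D) (ht : t ∈ P) :
    iteratedFDeriv ℂ i (fun z => f (z, t)) z =
      (iteratedFDeriv ℂ i f (z, t)).compContinuousLinearMap
        (fun _ => ContinuousLinearMap.inl ℂ E T) := by
  set g : E × T → F := fun p => f ((0, t) + p) with hg
  have hO : IsOpen ((fun p : E × T => (0, t) + p) ⁻¹' (D ×ˢ P)) :=
    (hD.prod hP).preimage (by fun_prop)
  have hgd : DifferentiableOn ℂ g ((fun p : E × T => (0, t) + p) ⁻¹' (D ×ˢ P)) :=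
    hf.comp (by fun_prop) (fun p hp => hp)
  have hzm : ContinuousLinearMap.inl ℂ E T z ∈ (fun p : E × T => (0, t) + p) ⁻¹' (D ×ˢ P) := by
    simp [hz, ht]
  have h1 := (ContinuousLinearMap.inl ℂ E T).iteratedFDerivWithin_comp_right (scv_contDiffOn_nat i hO hgd)
    hO.uniqueDiffOn (hO.preimage (ContinuousLinearMap.inl ℂ E T).continuous).uniqueDiffOn hzm
    (i := i) le_rfl
  rw [iteratedFDerivWithin_of_isOpen i hO hzm,
    iteratedFDerivWithin_of_isOpen i (hO.preimage (ContinuousLinearMap.inl ℂ E T).continuous) hzm] at h1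
  have h2 : g ∘ (ContinuousLinearMap.inl ℂ E T) = fun z => f (z, t) := by
    ext z; simp [hg]
  rw [h2] at h1
  rw [h1, hg, iteratedFDeriv_comp_add_left]
  simp

theorem slice_diff {f : E × T → F} {D : Set E} {P : Set T} (hD : IsOpen D) (hP : IsOpen P)
    (hf : DifferentiableOn ℂ f (D ×ˢ P)) (i : ℕ) :
    DifferentiableOn ℂ (fun p : E × T => iteratedFDeriv ℂ i (fun z => f (z, p.2)) p.1) (D ×ˢ P) := by
  have h1 := scv_iter_diff (hD.prod hP) hf i
  have h2 := (ContinuousMultilinearMap.compContinuousLinearMapL (F := F) (𝕜 := ℂ)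
    (fun _ : Fin i => ContinuousLinearMap.inl ℂ E T)).differentiable.comp_differentiableOn h1
  refine h2.congr fun p hp => ?_
  exact slice_eq hD hP hf i hp.1 hp.2

end Slices


section Solver

theorem implicit_diff {X V : Type} [NormedAddCommGroup X] [NormedSpace ℂ X]
    [NormedAddCommGroup V] [NormedSpace ℂ V] [FiniteDimensional ℂ V]
    {Ψ : X × V → V} {S : X → V} {x₀ : X} {K : ℝ}
    (hd : DifferentiableAt ℂ Ψ (x₀, S x₀)) (h0 : Ψ (x₀, S x₀) = 0)
    (hK : ∀ᶠ p in nhds (x₀, S x₀), ‖S p.1 - p.2‖ ≤ K * ‖Ψ p‖) :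
    DifferentiableAt ℂ S x₀ := by
  set s₀ := S x₀ with hs₀
  set Ψ' := fderiv ℂ Ψ (x₀, s₀) with hΨ'
  have hΨ : HasFDerivAt Ψ Ψ' (x₀, s₀) := hd.hasFDerivAt
  set A1 : X →L[ℂ] V := Ψ'.comp (ContinuousLinearMap.inl ℂ X V)
  set A2 : V →L[ℂ] V := Ψ'.comp (ContinuousLinearMap.inr ℂ X V) with hA2
  have hinj : Function.Injective A2 := by
    rw [injective_iff_map_eq_zero]
    intro v hv
    by_contra hne
    have hline : HasDerivAt (fun e : ℂ => ((x₀, s₀ + e • v) : X × V)) ((0, v) : X × V) 0 := by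
      have h1 : HasDerivAt (fun e : ℂ => s₀ + e • v) v 0 := by
        simpa using ((hasDerivAt_id (0:ℂ)).smul_const v).const_add s₀
      exact (hasDerivAt_const (0:ℂ) x₀).prodMk h1
    have hl0 : ((x₀, s₀ + (0:ℂ) • v) : X × V) = (x₀, s₀) := by simp
    have hφ : HasDerivAt (fun e : ℂ => Ψ (x₀, s₀ + e • v)) (Ψ' (0, v)) 0 := by
      have h2 : HasFDerivAt Ψ Ψ' (x₀, s₀ + (0:ℂ) • v) := by rw [hl0]; exact hΨ
      exact h2.comp_hasDerivAt (0:ℂ) hline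
    have hv' : Ψ' (0, v) = 0 := by simpa [hA2] using hv
    rw [hv'] at hφ
    have hlo := hφ.isLittleO
    simp only [zero_smul, add_zero, h0, sub_zero, smul_zero] at hlo
    have hO : (fun e : ℂ => e) =O[nhds 0] (fun e : ℂ => Ψ (x₀, s₀ + e • v)) := by
      have hc : Tendsto (fun e : ℂ => ((x₀, s₀ + e • v) : X × V)) (nhds 0) (nhds (x₀, s₀)) := by
        have := hline.continuousAt.tendsto
        rwa [hl0] at this
      have hvn : 0 < ‖v‖ := norm_pos_iff.2 hne
      refine Asymptotics.IsBigO.of_bound (K / ‖v‖) ?_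
      filter_upwards [hc.eventually hK] with e he
      simp only [← hs₀, sub_add_cancel_left, norm_neg, norm_smul] at he
      rw [div_mul_eq_mul_div, le_div_iff₀ hvn]
      exact he
    have h3 := hO.trans_isLittleO hlo
    have h4 := Asymptotics.isLittleO_irrefl (f'' := fun e : ℂ => e) (l := nhdsWithin (0:ℂ) {0}ᶜ) (by
      apply Eventually.frequently
      filter_upwards [self_mem_nhdsWithin] with e he using by simpa using he)
    exact h4 (h3.mono nhdsWithin_le_nhds)
  have hsurj : Function.Surjective A2 := LinearMap.injective_iff_surjective.1 hinj
  let e : V ≃L[ℂ] V := (LinearEquiv.ofBijective A2.toLinearMap ⟨hinj, hsurj⟩).toContinuousLinearEquiv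
  have he : ∀ v, A2 (e.symm v) = v := fun v =>
    (LinearEquiv.ofBijective A2.toLinearMap ⟨hinj, hsurj⟩).apply_symm_apply v
  set S' : X →L[ℂ] V := -(e.symm : V →L[ℂ] V).comp A1 with hS'
  have hline : HasFDerivAt (fun x : X => ((x, s₀ + S' (x - x₀)) : X × V))
      ((ContinuousLinearMap.id ℂ X).prod S') x₀ := by
    refine (hasFDerivAt_id x₀).prodMk ?_
    have h1 : HasFDerivAt (fun x => x - x₀) (ContinuousLinearMap.id ℂ X) x₀ := (hasFDerivAt_id x₀).sub_const x₀
    exact (S'.hasFDerivAt.comp x₀ h1).const_add s₀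
  have hl0 : ((x₀, s₀ + S' (x₀ - x₀)) : X × V) = (x₀, s₀) := by simp
  have hφ : HasFDerivAt (fun x : X => Ψ (x, s₀ + S' (x - x₀))) (0 : X →L[ℂ] V) x₀ := by
    have h2 : HasFDerivAt Ψ Ψ' (x₀, s₀ + S' (x₀ - x₀)) := by rw [hl0]; exact hΨ
    have h3 := h2.comp x₀ hline
    have h4 : (0 : X →L[ℂ] V) = Ψ'.comp ((ContinuousLinearMap.id ℂ X).prod S') := ?_
    · rw [h4]; exact h3
    ext x
    have h5 : Ψ' (x, S' x) = A1 x + A2 (S' x) := by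
      simp only [A1, A2, ContinuousLinearMap.comp_apply, ← map_add]
      simp
    change (0 : V) = Ψ' (x, S' x)
    rw [h5]
    simp [hS', he]
  refine HasFDerivAt.differentiableAt (f' := S') ?_
  rw [hasFDerivAt_iff_isLittleO_nhds_zero]
  rw [hasFDerivAt_iff_isLittleO_nhds_zero] at hφ
  have hc : Tendsto (fun h : X => ((x₀ + h, s₀ + S' (x₀ + h - x₀)) : X × V)) (nhds 0) (nhds (x₀, s₀)) := by
    have h6 : Continuous (fun h : X => ((x₀ + h, s₀ + S' (x₀ + h - x₀)) : X × V)) := by fun_prop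
    have := h6.tendsto 0
    simpa using this
  refine Asymptotics.IsBigO.trans_isLittleO ?_ hφ
  refine Asymptotics.IsBigO.of_bound K ?_
  filter_upwards [hc.eventually hK] with h hh
  simp only [sub_self, map_zero, add_zero, h0, sub_zero, zero_apply]
  rw [← hs₀, sub_sub]
  simpa using hh

/-- Hypotheses on a family of maps used by the solver. -/
structure Fam {Y V : Type} [TopologicalSpace Y] [NormedAddCommGroup V]
    (Q : Set Y) (P U : Set V) (δ M : ℝ) (f : Y × V → V) : Prop where
  cont : ContinuousOn f (Q ×ˢ P)
  bd : ∀ p ∈ Q ×ˢ P, ‖f p‖ ≤ M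
  lip : ∀ y ∈ Q, ∀ t ∈ U, ∀ x ∈ closedBall t (2 * δ / 5), ∀ x' ∈ closedBall t (2 * δ / 5),
    ‖f (y, x) - f (y, x')‖ ≤ 2 * M / δ * ‖x - x'‖

section

variable {Y V : Type} [TopologicalSpace Y] [NormedAddCommGroup V]
    {Q : Set Y} {P U : Set V} {δ M : ℝ} {a b c : Y × V → V}

/-- `s` solves the equation with parameters `(y, t)`. -/
def IsSol (δ : ℝ) (a b c : Y × V → V) (y : Y) (t s : V) : Prop :=
  ‖s‖ ≤ 2 * δ / 5 ∧ s + b (y, t + s) = a (y, t) + c (y, t + a (y, t))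

theorem solver_core (hδ : 0 < δ) (hM : M ≤ 5 / 18 * δ)
    (hb : Fam Q P U δ M b) {y : Y} {t s s' : V} (hy : y ∈ Q) (ht : t ∈ U)
    (hs : ‖s‖ ≤ 2 * δ / 5) (hs' : ‖s'‖ ≤ 2 * δ / 5) :
    ‖s - s'‖ ≤ 9 / 4 * ‖(s + b (y, t + s)) - (s' + b (y, t + s'))‖ := by
  have h1 := hb.lip y hy t ht (t + s) (by simpa using hs) (t + s') (by simpa using hs')
  have h2 : 2 * M / δ ≤ 5 / 9 := by rw [div_le_iff₀ hδ]; linarith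
  rw [add_sub_add_left_eq_sub] at h1
  have h3 : s - s' = ((s + b (y, t + s)) - (s' + b (y, t + s'))) - (b (y, t + s) - b (y, t + s')) := by abel
  have h4 : ‖s - s'‖ ≤ ‖(s + b (y, t + s)) - (s' + b (y, t + s'))‖ + ‖b (y, t + s) - b (y, t + s')‖ := by
    nth_rw 1 [h3]
    exact norm_sub_le _ _
  have h5 : 2 * M / δ * ‖s - s'‖ ≤ 5 / 9 * ‖s - s'‖ := by gcongr
  linarith

theorem solver_bound (hδ : 0 < δ) (hM : M ≤ 5 / 18 * δ)
    (hPU : ∀ t ∈ U, closedBall t (2 * δ / 5) ⊆ P) 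
    (ha : Fam Q P U δ M a) (hb : Fam Q P U δ M b) (hc : Fam Q P U δ M c)
    (habc : ∀ p ∈ Q ×ˢ P, c p = b p - a p)
    {y : Y} {t s : V} (hy : y ∈ Q) (ht : t ∈ U) (hs : IsSol δ a b c y t s) :
    ‖s‖ ≤ 9 / 2 * M ^ 2 / δ := by
  have htP : t ∈ P := hPU t ht (mem_closedBall_self (by positivity))
  have hA := ha.bd (y, t) ⟨hy, htP⟩
  have h0 := solver_core hδ hM hb hy ht hs.1 (s' := 0) (by simp; positivity)
  have h1 : (s + b (y, t + s)) - (0 + b (y, t + 0)) = c (y, t + a (y, t)) - c (y, t) := by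
    rw [hs.2, habc (y, t) ⟨hy, htP⟩]
    simp only [add_zero, zero_add]; abel
  have h2 := hc.lip y hy t ht (t + a (y, t)) (by simp; linarith) t
    (mem_closedBall_self (by positivity))
  rw [h1, sub_zero] at h0
  rw [add_sub_cancel_left] at h2
  have hM0 : 0 ≤ M := (norm_nonneg _).trans hA
  calc ‖s‖ ≤ _ := h0
    _ ≤ 9 / 4 * (2 * M / δ * M) := by
        gcongr
        refine h2.trans ?_
        gcongr
    _ = _ := by ring

theorem solver_exists [CompleteSpace V] (hδ : 0 < δ) (hM : M ≤ 5 / 18 * δ)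
    (hPU : ∀ t ∈ U, closedBall t (2 * δ / 5) ⊆ P) 
    (ha : Fam Q P U δ M a) (hb : Fam Q P U δ M b) (hc : Fam Q P U δ M c)
    (habc : ∀ p ∈ Q ×ˢ P, c p = b p - a p)
    {y : Y} {t : V} (hy : y ∈ Q) (ht : t ∈ U) : ∃ s, IsSol δ a b c y t s := by
  have htP : t ∈ P := hPU t ht (mem_closedBall_self (by positivity))
  have hA := ha.bd (y, t) ⟨hy, htP⟩
  have hM0 : 0 ≤ M := (norm_nonneg _).trans hA
  have hL : 2 * M / δ ≤ 5 / 9 := by rw [div_le_iff₀ hδ]; linarith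
  have hc1 := hc.lip y hy t ht (t + a (y, t)) (by simp; linarith) t
    (mem_closedBall_self (by positivity))
  rw [add_sub_cancel_left] at hc1
  set Φ : V → V := fun s => a (y, t) + c (y, t + a (y, t)) - b (y, t + s) with hΦ
  have hlip : ∀ s ∈ closedBall (0:V) (2 * δ / 5), ∀ s' ∈ closedBall (0:V) (2 * δ / 5),
      ‖Φ s - Φ s'‖ ≤ 5 / 9 * ‖s - s'‖ := by
    intro s hs s' hs'
    have h1 := hb.lip y hy t ht (t + s') (by simpa using hs') (t + s) (by simpa using hs)
    rw [add_sub_add_left_eq_sub] at h1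
    have : Φ s - Φ s' = b (y, t + s') - b (y, t + s) := by simp only [hΦ]; abel
    rw [this, norm_sub_rev s s']
    exact h1.trans (by gcongr)
  have h00 : (0:V) ∈ closedBall (0:V) (2 * δ / 5) := mem_closedBall_self (by positivity)
  have hmaps : MapsTo Φ (closedBall (0:V) (2 * δ / 5)) (closedBall (0:V) (2 * δ / 5)) := by
    intro s hs
    have h1 := hlip s hs 0 h00
    have h2 : Φ 0 = c (y, t + a (y, t)) - c (y, t) := by
      rw [habc (y, t) ⟨hy, htP⟩]; simp only [hΦ, add_zero]; abel
    rw [mem_closedBall_zero_iff] at hs ⊢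
    rw [sub_zero] at h1
    have h3 : ‖Φ 0‖ ≤ 5 / 9 * M := by
      rw [h2]; refine hc1.trans ?_; gcongr
    have h4 : ‖Φ s‖ ≤ ‖Φ s - Φ 0‖ + ‖Φ 0‖ := by
      simpa using norm_add_le (Φ s - Φ 0) (Φ 0)
    linarith
  have hcontr : ContractingWith (5 / 9) (MapsTo.restrict Φ _ _ hmaps) := by
    refine ⟨by rw [div_lt_one] <;> norm_num, ?_⟩
    apply LipschitzWith.of_dist_le_mul
    intro s s'
    have := hlip s s.2 s' s'.2
    rw [Subtype.dist_eq, Subtype.dist_eq, dist_eq_norm, dist_eq_norm]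
    simpa using this
  obtain ⟨s, hs, hfix, -⟩ := ContractingWith.exists_fixedPoint' (isClosed_closedBall.isComplete) hmaps hcontr
    h00 (edist_ne_top _ _)
  refine ⟨s, by simpa using hs, ?_⟩
  have : Φ s = s := hfix
  nth_rw 1 [← this]
  simp only [hΦ]; abel

theorem solver_cont (hδ : 0 < δ) (hM : M ≤ 5 / 18 * δ)
    (hPU : ∀ t ∈ U, closedBall t (2 * δ / 5) ⊆ P) (hP : IsOpen P)
    (ha : Fam Q P U δ M a) (hb : Fam Q P U δ M b) (hc : Fam Q P U δ M c)
    {S : Y × V → V} (hS : ∀ y ∈ Q, ∀ t ∈ U, IsSol δ a b c y t (S (y, t))) :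
    ContinuousOn S (Q ×ˢ U) := by
  have hmem : ∀ t ∈ U, ∀ s : V, ‖s‖ ≤ 2 * δ / 5 → t + s ∈ P := fun t ht s hs =>
    hPU t ht (by simpa using hs)
  have hUP : U ⊆ P := fun t ht => hPU t ht (mem_closedBall_self (by positivity))
  rintro ⟨y₀, t₀⟩ ⟨hy₀, ht₀⟩
  have hs₀ := hS y₀ hy₀ t₀ ht₀
  set s₀ := S (y₀, t₀) with hs₀def
  have hshift : ∀ {f : Y × V → V} {g : Y × V → V}, ContinuousOn f (Q ×ˢ P) →
      ContinuousWithinAt g (Q ×ˢ U) (y₀, t₀) → t₀ + g (y₀, t₀) ∈ P →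
      ContinuousWithinAt (fun p : Y × V => f (p.1, p.2 + g p)) (Q ×ˢ U) (y₀, t₀) := by
    intro f g hf hg hm
    have h1 : ContinuousWithinAt (fun p : Y × V => ((p.1, p.2 + g p) : Y × V)) (Q ×ˢ U) (y₀, t₀) :=
      (continuous_fst.continuousWithinAt).prodMk (continuous_snd.continuousWithinAt.add hg)
    have h2 : ∀ᶠ p in nhdsWithin (y₀, t₀) (Q ×ˢ U), ((p.1, p.2 + g p) : Y × V) ∈ Q ×ˢ P := by
      have h3 : ∀ᶠ p in nhdsWithin (y₀, t₀) (Q ×ˢ U), p.2 + g p ∈ P :=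
        (continuous_snd.continuousWithinAt.add hg).tendsto.eventually (hP.mem_nhds hm)
      filter_upwards [h3, self_mem_nhdsWithin] with p hp hp' using ⟨hp'.1, hp⟩
    exact Tendsto.comp (hf (y₀, t₀ + g (y₀, t₀)) ⟨hy₀, hm⟩)
      (tendsto_nhdsWithin_iff.2 ⟨h1, h2⟩)
  have haU : ContinuousWithinAt a (Q ×ˢ U) (y₀, t₀) :=
    (ha.cont _ ⟨hy₀, hUP ht₀⟩).mono (prod_mono le_rfl hUP)
  have hA := ha.bd (y₀, t₀) ⟨hy₀, hUP ht₀⟩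
  have hR : ContinuousWithinAt (fun p : Y × V => (a p + c (p.1, p.2 + a p)) - (s₀ + b (p.1, p.2 + s₀)))
      (Q ×ˢ U) (y₀, t₀) := by
    refine (haU.add (hshift hc.cont haU (hmem _ ht₀ _ (by linarith)))).sub
      (continuousWithinAt_const.add ?_)
    exact hshift hb.cont (g := fun _ => s₀) continuousWithinAt_const (hmem _ ht₀ _ hs₀.1)
  have hR0 : (a (y₀, t₀) + c (y₀, t₀ + a (y₀, t₀))) - (s₀ + b (y₀, t₀ + s₀)) = 0 := by
    rw [hs₀.2, sub_self]
  rw [ContinuousWithinAt, tendsto_iff_norm_sub_tendsto_zero]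
  have ht := (hR.norm.const_mul (9 / 4)).tendsto
  simp only [hR0, norm_zero, mul_zero] at ht
  refine squeeze_zero' (Eventually.of_forall fun _ => norm_nonneg _) ?_ ht
  filter_upwards [self_mem_nhdsWithin] with p hp
  have hsp := hS p.1 hp.1 p.2 hp.2
  have := solver_core hδ hM hb hp.1 hp.2 hsp.1 hs₀.1
  rwa [hsp.2] at this

end

theorem solver_diff {Y V : Type} [NormedAddCommGroup Y] [NormedSpace ℂ Y] [NormedAddCommGroup V]
    [NormedSpace ℂ V] [FiniteDimensional ℂ V]
    {Q Q' : Set Y} {P U : Set V} {δ M : ℝ} {a b c : Y × V → V} (hδ : 0 < δ) (hM : M ≤ 5 / 18 * δ)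
    (hPU : ∀ t ∈ U, closedBall t (2 * δ / 5) ⊆ P) (hP : IsOpen P) (hU : IsOpen U)
    (hQ' : IsOpen Q') (hQQ : Q' ⊆ Q)
    (ha : Fam Q P U δ M a) (hb : Fam Q P U δ M b) (hc : Fam Q P U δ M c)
    (habc : ∀ p ∈ Q ×ˢ P, c p = b p - a p)
    (da : DifferentiableOn ℂ a (Q' ×ˢ P)) (db : DifferentiableOn ℂ b (Q' ×ˢ P))
    (dc : DifferentiableOn ℂ c (Q' ×ˢ P))
    {S : Y × V → V} (hS : ∀ y ∈ Q, ∀ t ∈ U, IsSol δ a b c y t (S (y, t))) :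
    DifferentiableOn ℂ S (Q' ×ˢ U) := by
  have hmem : ∀ t ∈ U, ∀ s : V, ‖s‖ ≤ 2 * δ / 5 → t + s ∈ P := fun t ht s hs =>
    hPU t ht (by simpa using hs)
  have hUP : U ⊆ P := fun t ht => hPU t ht (mem_closedBall_self (by positivity))
  rintro ⟨y₀, t₀⟩ ⟨hy₀, ht₀⟩
  apply DifferentiableAt.differentiableWithinAt
  have hs₀ := hS y₀ (hQQ hy₀) t₀ ht₀
  have hbd := solver_bound hδ hM hPU ha hb hc habc (hQQ hy₀) ht₀ hs₀
  have hA := ha.bd (y₀, t₀) ⟨hQQ hy₀, hUP ht₀⟩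
  have hM0 : 0 ≤ M := (norm_nonneg _).trans hA
  have hlt : ‖S (y₀, t₀)‖ < 2 * δ / 5 := by
    refine hbd.trans_lt ?_
    rw [div_lt_iff₀ hδ]
    nlinarith
  have dat : ∀ {f : Y × V → V}, DifferentiableOn ℂ f (Q' ×ˢ P) → ∀ t ∈ P, DifferentiableAt ℂ f (y₀, t) :=
    fun hf t ht => (hf (y₀, t) ⟨hy₀, ht⟩).differentiableAt ((hQ'.prod hP).mem_nhds ⟨hy₀, ht⟩)
  refine implicit_diff (K := 9 / 4)
    (Ψ := fun q : (Y × V) × V => (q.2 + b (q.1.1, q.1.2 + q.2)) - (a q.1 + c (q.1.1, q.1.2 + a q.1)))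
    ?_ ?_ ?_
  · have e1 : DifferentiableAt ℂ (fun q : (Y × V) × V => b (q.1.1, q.1.2 + q.2)) ((y₀, t₀), S (y₀, t₀)) :=
      DifferentiableAt.comp (g := b) (f := fun q : (Y × V) × V => ((q.1.1, q.1.2 + q.2) : Y × V)) _
        (dat db _ (hmem _ ht₀ _ hs₀.1)) (by fun_prop)
    have e2 : DifferentiableAt ℂ (fun q : (Y × V) × V => a q.1) ((y₀, t₀), S (y₀, t₀)) :=
      DifferentiableAt.comp (g := a) (f := fun q : (Y × V) × V => q.1) _
        (dat da _ (hUP ht₀)) (by fun_prop)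
    have e3 : DifferentiableAt ℂ (fun q : (Y × V) × V => c (q.1.1, q.1.2 + a q.1)) ((y₀, t₀), S (y₀, t₀)) :=
      DifferentiableAt.comp (g := c) (f := fun q : (Y × V) × V => ((q.1.1, q.1.2 + a q.1) : Y × V)) _
        (dat dc _ (hmem _ ht₀ _ (by linarith)))
        (DifferentiableAt.prodMk (by fun_prop) (DifferentiableAt.add (by fun_prop) e2))
    exact (differentiableAt_snd.add e1).sub (e2.add e3)
  · simp only [hs₀.2, sub_self]
  · have h1 : ∀ᶠ p : (Y × V) × V in nhds ((y₀, t₀), S (y₀, t₀)), p.1 ∈ Q' ×ˢ U :=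
      continuous_fst.continuousAt.eventually ((hQ'.prod hU).mem_nhds ⟨hy₀, ht₀⟩)
    have h2 : ∀ᶠ p : (Y × V) × V in nhds ((y₀, t₀), S (y₀, t₀)), ‖p.2‖ < 2 * δ / 5 :=
      (continuous_snd.norm.continuousAt (x := ((y₀, t₀), S (y₀, t₀)))).eventually
        (isOpen_Iio.mem_nhds hlt)
    filter_upwards [h1, h2] with p hp1 hp2
    have hsp := hS p.1.1 (hQQ hp1.1) p.1.2 hp1.2
    have := solver_core hδ hM hb (hQQ hp1.1) hp1.2 hsp.1 hp2.le
    rw [hsp.2] at this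
    rw [norm_sub_rev (p.2 + _)]
    exact this

end Solver


section Jets

variable {E V : Type} [NormedAddCommGroup E] [NormedSpace ℂ E] [FiniteDimensional ℂ E]
  [NormedAddCommGroup V] [NormedSpace ℂ V] [FiniteDimensional ℂ V]

/-- Jets of order at most `r` in the first variable of a map of class `A^{r,0}`. -/
structure Jet (r : ℕ) (D : Set E) (P : Set V) (M₀ : ℝ) (f : E × V → V)
    (J : ∀ i : ℕ, E × V → ContinuousMultilinearMap ℂ (fun _ : Fin i => E) V) : Prop where
  cont : ∀ i ≤ r, ContinuousOn (J i) (closure D ×ˢ P)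
  eq : ∀ i ≤ r, ∀ z ∈ D, ∀ t ∈ P, J i (z, t) = iteratedFDeriv ℂ i (fun z => f (z, t)) z
  bd : ∀ i ≤ r, ∀ p ∈ closure D ×ˢ P, ‖J i p‖ ≤ M₀
  zero : ∀ p ∈ closure D ×ˢ P, ∀ v, J 0 p v = f p
  diff : DifferentiableOn ℂ f (D ×ˢ P)

/-- The Taylor polynomial in the first variable. -/
def hat (r : ℕ) (J : ∀ i : ℕ, E × V → ContinuousMultilinearMap ℂ (fun _ : Fin i => E) V)
    (p : (E × E) × V) : V :=
  ∑ i ∈ Finset.range (r + 1), ((i.factorial : ℂ)⁻¹) • J i (p.1.1, p.2) (fun _ => p.1.2)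

variable {r : ℕ} {D : Set E} {P U : Set V} {M₀ δ : ℝ} {f : E × V → V}
    {J : ∀ i : ℕ, E × V → ContinuousMultilinearMap ℂ (fun _ : Fin i => E) V}

theorem hat_zero (h : Jet r D P M₀ f J) {z : E} {t : V} (hz : z ∈ closure D) (ht : t ∈ P) :
    hat r J ((z, 0), t) = f (z, t) := by
  unfold hat
  rw [Finset.sum_eq_single 0]
  · simp [h.zero (z, t) ⟨hz, ht⟩]
  · intro i _ hi
    have : J i (z, t) (fun _ => (0:E)) = 0 := by
      have : Nonempty (Fin i) := ⟨⟨0, Nat.pos_of_ne_zero hi⟩⟩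
      exact (J i (z, t)).map_zero
    simp [this]
  · simp

theorem hat_cont (h : Jet r D P M₀ f J) (S : Set E) :
    ContinuousOn (hat r J) ((closure D ×ˢ S) ×ˢ P) := by
  unfold hat
  refine continuousOn_finsetSum _ fun i hi => ?_
  have hi' : i ≤ r := Nat.lt_succ_iff.mp (Finset.mem_range.mp hi)
  refine ContinuousOn.const_smul ?_ _
  refine ContinuousOn.eval (f := fun p : (E × E) × V => J i (p.1.1, p.2)) ?_ ?_
  · exact (h.cont i hi').comp (by fun_prop) (fun p hp => ⟨hp.1.1, hp.2⟩)
  · fun_prop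

theorem hat_bd (h : Jet r D P M₀ f J) :
    ∀ p ∈ (closure D ×ˢ closedBall (0:E) (1/10)) ×ˢ P, ‖hat r J p‖ ≤ 10 / 9 * M₀ := by
  rintro ⟨⟨z, ζ⟩, t⟩ ⟨⟨hz, hζ⟩, ht⟩
  have hζ' : ‖ζ‖ ≤ 1 / 10 := by simpa using hζ
  have hM : 0 ≤ M₀ := (norm_nonneg _).trans (h.bd 0 (Nat.zero_le _) (z, t) ⟨hz, ht⟩)
  have hterm : ∀ i ∈ Finset.range (r + 1),
      ‖((i.factorial : ℂ)⁻¹) • J i (z, t) (fun _ => ζ)‖ ≤ M₀ * (1 / 10 : ℝ) ^ i := by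
    intro i hi
    have hi' : i ≤ r := Nat.lt_succ_iff.mp (Finset.mem_range.mp hi)
    rw [norm_smul]
    have h1 : ‖((i.factorial : ℂ)⁻¹)‖ ≤ 1 := by
      rw [norm_inv, Complex.norm_natCast]
      exact inv_le_one_of_one_le₀ (by exact_mod_cast Nat.one_le_iff_ne_zero.mpr (Nat.factorial_ne_zero i))
    have h2 : ‖J i (z, t) (fun _ => ζ)‖ ≤ M₀ * (1 / 10 : ℝ) ^ i := by
      refine ((J i (z, t)).le_opNorm _).trans ?_
      simp only [Finset.prod_const, Finset.card_univ, Fintype.card_fin]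
      have := h.bd i hi' (z, t) ⟨hz, ht⟩
      gcongr
    calc _ ≤ 1 * (M₀ * (1 / 10 : ℝ) ^ i) := by gcongr
      _ = _ := one_mul _
  unfold hat
  refine (norm_sum_le_of_le _ hterm).trans ?_
  rw [← Finset.mul_sum, mul_comm]
  have : ∑ i ∈ Finset.range (r + 1), (1 / 10 : ℝ) ^ i ≤ 10 / 9 := by
    rw [geom_sum_eq (by norm_num)]
    have : (0:ℝ) ≤ (1 / 10) ^ (r + 1) := by positivity
    rw [div_le_iff_of_neg (by norm_num)]; linarith
  gcongr

theorem hat_diff (hD : IsOpen D) (hP : IsOpen P) (h : Jet r D P M₀ f J) (S : Set E) :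
    DifferentiableOn ℂ (hat r J) ((D ×ˢ S) ×ˢ P) := by
  unfold hat
  refine DifferentiableOn.fun_sum fun i hi => ?_
  have hi' : i ≤ r := Nat.lt_succ_iff.mp (Finset.mem_range.mp hi)
  refine DifferentiableOn.fun_const_smul ?_ _
  have h1 : DifferentiableOn ℂ (J i) (D ×ˢ P) :=
    (slice_diff hD hP h.diff i).congr (fun p hp => h.eq i hi' p.1 hp.1 p.2 hp.2)
  have h2 : DifferentiableOn ℂ (fun p : (E × E) × V => J i (p.1.1, p.2)) ((D ×ˢ S) ×ˢ P) :=
    h1.comp (by fun_prop) (fun p hp => ⟨hp.1.1, hp.2⟩)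
  intro p hp
  have h3 := (h2 p hp).hasFDerivWithinAt
  have h4 : ∀ _ : Fin i, HasFDerivWithinAt (fun p : (E × E) × V => p.1.2)
      ((ContinuousLinearMap.snd ℂ E E).comp (ContinuousLinearMap.fst ℂ (E × E) V)) ((D ×ˢ S) ×ˢ P) p := fun _ => by
    exact ((ContinuousLinearMap.snd ℂ E E).comp (ContinuousLinearMap.fst ℂ (E × E) V)).hasFDerivWithinAt
  exact (h3.continuousMultilinearMap_apply h4).differentiableWithinAt

theorem hat_fam (hδ : 0 < δ) (hD : IsOpen D) (hP : IsOpen P) (h : Jet r D P M₀ f J)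
    (hU : ∀ t ∈ U, ball t (9 * δ / 10) ⊆ P) :
    Fam (closure D ×ˢ closedBall (0:E) (1/10)) P U δ (10 / 9 * M₀) (hat r J) where
  cont := hat_cont h _
  bd := hat_bd h
  lip := by
    rintro ⟨z, ζ⟩ ⟨hz, hζ⟩ t ht x hx x' hx'
    have hsub : closedBall t (2 * δ / 5) ⊆ P :=
      (closedBall_subset_ball (by linarith)).trans (hU t ht)
    have key : ∀ w ∈ D, ‖hat r J ((w, ζ), x) - hat r J ((w, ζ), x')‖ ≤
        2 * (10 / 9 * M₀) / δ * ‖x - x'‖ := by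
      intro w hw
      have hdP : DifferentiableOn ℂ (fun y => hat r J ((w, ζ), y)) P :=
        (hat_diff hD hP h (closedBall 0 (1/10))).comp (by fun_prop) (fun y hy => ⟨⟨hw, hζ⟩, hy⟩)
      have hball : ∀ y ∈ closedBall t (2 * δ / 5), ball y (δ / 2) ⊆ P := by
        intro y hy
        refine Subset.trans (ball_subset_ball' ?_) (hU t ht)
        rw [mem_closedBall] at hy
        linarith
      have := Convex.norm_image_sub_le_of_norm_fderiv_le (𝕜 := ℂ)
        (f := fun y => hat r J ((w, ζ), y)) (C := (10 / 9 * M₀) / (δ / 2)) (s := closedBall t (2 * δ / 5))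
        (fun y hy => (hdP.differentiableAt (hP.mem_nhds (hsub hy))))
        (fun y hy => scv_cauchy_one (by positivity) (hdP.mono (hball y hy))
          (fun y' hy' => hat_bd h _ ⟨⟨subset_closure hw, hζ⟩, hball y hy hy'⟩))
        (convex_closedBall _ _) hx' hx
      refine this.trans (le_of_eq ?_)
      field_simp
    have hcw : ∀ y ∈ P, ContinuousWithinAt (fun w => hat r J ((w, ζ), y)) D z := by
      intro y hy
      have h1 : ContinuousWithinAt (hat r J) ((closure D ×ˢ closedBall (0:E) (1/10)) ×ˢ P) ((z, ζ), y) :=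
        hat_cont h _ _ ⟨⟨hz, hζ⟩, hy⟩
      refine ContinuousWithinAt.comp (f := fun w => ((w, ζ), y)) h1 (by fun_prop) ?_
      exact fun w hw => ⟨⟨subset_closure hw, hζ⟩, hy⟩
    exact ContinuousWithinAt.closure_le hz ((hcw x (hsub hx)).sub (hcw x' (hsub hx'))).norm
      continuousWithinAt_const key

theorem hat_taylor (hD : IsOpen D) (h : Jet r D P M₀ f J) {z₀ : E} (hz : z₀ ∈ D) :
    ∃ B ρ : ℝ, 0 < ρ ∧ ball z₀ ρ ⊆ D ∧ ∀ ζ : E, ‖ζ‖ < ρ → ∀ t ∈ P,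
      ‖f (z₀ + ζ, t) - hat r J ((z₀, ζ), t)‖ ≤ B * ‖ζ‖ ^ (r + 1) := by
  obtain ⟨ε, hε, hs⟩ := Metric.isOpen_iff.mp hD z₀ hz
  refine ⟨cauchyK (r+1) * M₀ / (ε/2)^(r+1), ε / 2, by positivity,
    (ball_subset_ball (by linarith)).trans hs, ?_⟩
  intro ζ hζ t ht
  have h2 : 2 * (ε / 2) = ε := by ring
  have := scv_taylor (f := fun z => f (z, t)) (x := z₀) (ρ := ε / 2) (M := M₀) (by positivity)
    (by rw [h2]; exact h.diff.comp (by fun_prop) (fun w hw => ⟨hs hw, ht⟩))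
    (by
      rw [h2]; intro y hy
      have hm : (y, t) ∈ closure D ×ˢ P := ⟨subset_closure (hs hy), ht⟩
      rw [← h.zero (y, t) hm 0]
      refine ((J 0 (y, t)).le_opNorm _).trans ?_
      simpa using h.bd 0 (Nat.zero_le _) _ hm) r hζ
  convert this using 3
  unfold hat
  refine Finset.sum_congr rfl fun i hi => ?_
  rw [h.eq i (Nat.lt_succ_iff.mp (Finset.mem_range.mp hi)) z₀ hz t ht]

theorem hat_sub (hD : IsOpen D) (hP : IsOpen P) {a b c : E × V → V} {Ja Jb Jc : ∀ i : ℕ, E × V → ContinuousMultilinearMap ℂ (fun _ : Fin i => E) V}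
    {Ma Mb Mc : ℝ} (ha : Jet r D P Ma a Ja) (hb : Jet r D P Mb b Jb) (hc : Jet r D P Mc c Jc)
    (habc : ∀ p ∈ closure D ×ˢ P, c p = b p - a p) :
    ∀ p ∈ (closure D ×ˢ closedBall (0:E) (1/10)) ×ˢ P, hat r Jc p = hat r Jb p - hat r Ja p := by
  rintro ⟨⟨z, ζ⟩, t⟩ ⟨⟨hz, hζ⟩, ht⟩
  unfold hat
  rw [← Finset.sum_sub_distrib]
  refine Finset.sum_congr rfl fun i hi => ?_
  have hi' : i ≤ r := Nat.lt_succ_iff.mp (Finset.mem_range.mp hi)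
  have hD' : ∀ w ∈ D, Jc i (w, t) = Jb i (w, t) - Ja i (w, t) := by
    intro w hw
    rw [ha.eq i hi' w hw t ht, hb.eq i hi' w hw t ht, hc.eq i hi' w hw t ht]
    have hsl : ∀ {f : E × V → V}, DifferentiableOn ℂ f (D ×ˢ P) → ContDiffAt ℂ i (fun z => f (z, t)) w := by
      intro f hf
      refine (scv_contDiffOn_nat i hD ?_).contDiffAt (hD.mem_nhds hw)
      exact hf.comp (by fun_prop) (fun w hw => ⟨hw, ht⟩)
    rw [← iteratedFDeriv_sub_apply (hsl hb.diff) (hsl ha.diff)]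
    refine (Filter.EventuallyEq.iteratedFDeriv ℂ ?_ i).eq_of_nhds
    filter_upwards [hD.mem_nhds hw] with w' hw'
    simpa using habc (w', t) ⟨subset_closure hw', ht⟩
  have hcts : ∀ {f : E × V → V} {M : ℝ} {J : ∀ i : ℕ, E × V → ContinuousMultilinearMap ℂ (fun _ : Fin i => E) V},
      Jet r D P M f J → ContinuousOn (fun w => J i (w, t)) (closure D) := fun h =>
    (h.cont i hi').comp (by fun_prop) (fun w hw => ⟨hw, ht⟩)
  have : EqOn (fun w => Jc i (w, t)) (fun w => Jb i (w, t) - Ja i (w, t)) (closure D) :=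
    Set.EqOn.of_subset_closure hD' (hcts hc) ((hcts hb).sub (hcts ha)) subset_closure le_rfl
  have h2 := this hz
  simp only at h2 ⊢
  rw [h2, ← smul_sub]
  rfl

end Jets


section Setup

variable {E V : Type} [NormedAddCommGroup E] [NormedSpace ℂ E] [FiniteDimensional ℂ E]
  [NormedAddCommGroup V] [NormedSpace ℂ V] [FiniteDimensional ℂ V]

/-- The standing assumptions of the construction. -/
structure Setup (r : ℕ) (D : Set E) (P U : Set V) (δ M₀ : ℝ) (a b c : E × V → V)
    (Ja Jb Jc : ∀ i : ℕ, E × V → ContinuousMultilinearMap ℂ (fun _ : Fin i => E) V)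
    (S : (E × E) × V → V) : Prop where
  hδ : 0 < δ
  hD : IsOpen D
  hP : IsOpen P
  hU : IsOpen U
  hUP : ∀ t ∈ U, ball t (9 * δ / 10) ⊆ P
  hM : 10 / 9 * M₀ ≤ 5 / 18 * δ
  ja : Jet r D P M₀ a Ja
  jb : Jet r D P M₀ b Jb
  jc : Jet r D P M₀ c Jc
  habc : ∀ p ∈ closure D ×ˢ P, c p = b p - a p
  sol : ∀ y ∈ closure D ×ˢ closedBall (0:E) (1/10), ∀ t ∈ U,
    IsSol δ (hat r Ja) (hat r Jb) (hat r Jc) y t (S (y, t))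

variable {r : ℕ} {D : Set E} {P U : Set V} {δ M₀ : ℝ} {a b c : E × V → V}
    {Ja Jb Jc : ∀ i : ℕ, E × V → ContinuousMultilinearMap ℂ (fun _ : Fin i => E) V}
    {S : (E × E) × V → V}

namespace Setup

theorem hPU (h : Setup r D P U δ M₀ a b c Ja Jb Jc S) :
    ∀ t ∈ U, closedBall t (2 * δ / 5) ⊆ P := fun t ht =>
  (closedBall_subset_ball (by linarith [h.hδ])).trans (h.hUP t ht)

theorem memP (h : Setup r D P U δ M₀ a b c Ja Jb Jc S) {t s : V} (ht : t ∈ U)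
    (hs : ‖s‖ ≤ 2 * δ / 5) : t + s ∈ P := h.hPU t ht (by simpa using hs)

theorem selfP (h : Setup r D P U δ M₀ a b c Ja Jb Jc S) {t : V} (ht : t ∈ U) : t ∈ P :=
  h.hPU t ht (mem_closedBall_self (by linarith [h.hδ]))

theorem S_cont (h : Setup r D P U δ M₀ a b c Ja Jb Jc S) :
    ContinuousOn S ((closure D ×ˢ closedBall (0:E) (1/10)) ×ˢ U) :=
  solver_cont h.hδ h.hM h.hPU h.hP (hat_fam h.hδ h.hD h.hP h.ja h.hUP)
    (hat_fam h.hδ h.hD h.hP h.jb h.hUP) (hat_fam h.hδ h.hD h.hP h.jc h.hUP) h.sol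

theorem S_diff (h : Setup r D P U δ M₀ a b c Ja Jb Jc S) :
    DifferentiableOn ℂ S ((D ×ˢ ball (0:E) (1/10)) ×ˢ U) :=
  solver_diff h.hδ h.hM h.hPU h.hP h.hU (h.hD.prod isOpen_ball)
    (Set.prod_mono subset_closure ball_subset_closedBall)
    (hat_fam h.hδ h.hD h.hP h.ja h.hUP)
    (hat_fam h.hδ h.hD h.hP h.jb h.hUP) (hat_fam h.hδ h.hD h.hP h.jc h.hUP)
    (hat_sub h.hD h.hP h.ja h.jb h.jc h.habc)
    (hat_diff h.hD h.hP h.ja _) (hat_diff h.hD h.hP h.jb _) (hat_diff h.hD h.hP h.jc _) h.sol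

theorem S_bd (h : Setup r D P U δ M₀ a b c Ja Jb Jc S) :
    ∀ y ∈ closure D ×ˢ closedBall (0:E) (1/10), ∀ t ∈ U,
      ‖S (y, t)‖ ≤ 9 / 2 * (10 / 9 * M₀) ^ 2 / δ := fun y hy t ht =>
  solver_bound h.hδ h.hM h.hPU 
    (hat_fam h.hδ h.hD h.hP h.ja h.hUP)
    (hat_fam h.hδ h.hD h.hP h.jb h.hUP) (hat_fam h.hδ h.hD h.hP h.jc h.hUP)
    (hat_sub h.hD h.hP h.ja h.jb h.jc h.habc) hy ht (h.sol y hy t ht)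

theorem mem0 {z : E} (hz : z ∈ closure D) : (z, (0:E)) ∈ closure D ×ˢ closedBall (0:E) (1/10) :=
  ⟨hz, mem_closedBall_self (by norm_num)⟩

theorem a_bd (h : Setup r D P U δ M₀ a b c Ja Jb Jc S) {y : E × E} {t : V}
    (hy : y ∈ closure D ×ˢ closedBall (0:E) (1/10)) (ht : t ∈ U) :
    ‖hat r Ja (y, t)‖ ≤ 2 * δ / 5 := by
  have := hat_bd h.ja (y, t) ⟨hy, h.selfP ht⟩
  linarith [h.hM, h.hδ]

theorem sol0 (h : Setup r D P U δ M₀ a b c Ja Jb Jc S) {z : E} {t : V} (hz : z ∈ closure D)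
    (ht : t ∈ U) : ‖a (z, t)‖ ≤ 2 * δ / 5 ∧ ‖S ((z, 0), t)‖ ≤ 2 * δ / 5 ∧
    S ((z, 0), t) + b (z, t + S ((z, 0), t)) = a (z, t) + c (z, t + a (z, t)) := by
  have h1 := h.sol _ (mem0 hz) t ht
  have h0 := h.a_bd (mem0 hz) ht
  rw [hat_zero h.ja hz (h.selfP ht)] at h0
  refine ⟨h0, h1.1, ?_⟩
  have h2 := h1.2
  rwa [hat_zero h.ja hz (h.selfP ht), hat_zero h.jb hz (h.memP ht h1.1),
    hat_zero h.jc hz (h.memP ht h0)] at h2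

theorem slice0 (h : Setup r D P U δ M₀ a b c Ja Jb Jc S) :
    DifferentiableOn ℂ (fun p : E × V => S ((p.1, 0), p.2)) (D ×ˢ U) :=
  h.S_diff.comp (by fun_prop) (fun p hp => ⟨⟨hp.1, mem_ball_self (by norm_num)⟩, hp.2⟩)

theorem sliceζ (h : Setup r D P U δ M₀ a b c Ja Jb Jc S) {z : E} {t : V} (hz : z ∈ D) (ht : t ∈ U) :
    DifferentiableOn ℂ (fun ζ : E => S ((z, ζ), t)) (ball 0 (1/10)) :=
  h.S_diff.comp (by fun_prop) (fun p hp => ⟨⟨hz, hp⟩, ht⟩)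

theorem S_close (h : Setup r D P U δ M₀ a b c Ja Jb Jc S) {z : E} (hz : z ∈ D) :
    ∃ B ρ : ℝ, 0 < ρ ∧ ρ ≤ 1 / 10 ∧ ball z ρ ⊆ D ∧ ∀ ζ : E, ‖ζ‖ < ρ → ∀ t ∈ U,
      ‖S ((z + ζ, 0), t) - S ((z, ζ), t)‖ ≤ B * ‖ζ‖ ^ (r + 1) := by
  obtain ⟨Ba, ρa, hρa, hsa, hTa⟩ := hat_taylor h.hD h.ja hz
  obtain ⟨Bb, ρb, hρb, hsb, hTb⟩ := hat_taylor h.hD h.jb hz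
  obtain ⟨Bc, ρc, hρc, hsc, hTc⟩ := hat_taylor h.hD h.jc hz
  refine ⟨9 / 4 * (Ba + 5 / 9 * Ba + Bc + Bb), min (min ρa ρb) (min ρc (1/10)), by positivity,
    (min_le_right _ _).trans (min_le_right _ _),
    (ball_subset_ball ((min_le_left _ _).trans (min_le_left _ _))).trans hsa, ?_⟩
  intro ζ hζ t ht
  rw [lt_min_iff, lt_min_iff, lt_min_iff] at hζ
  obtain ⟨⟨h1, h2⟩, h3, h4⟩ := hζ
  have hzζ : z + ζ ∈ closure D := subset_closure (hsa (by simpa using h1))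
  have hy : (z, ζ) ∈ closure D ×ˢ closedBall (0:E) (1/10) :=
    ⟨subset_closure hz, by simpa using h4.le⟩
  obtain ⟨ha1, hs1, heq1⟩ := h.sol0 hzζ ht
  obtain ⟨hs2, heq2⟩ := h.sol _ hy t ht
  have ha2 := h.a_bd hy ht
  set s₁ := S ((z + ζ, 0), t)
  set s₂ := S ((z, ζ), t)
  have hcore := solver_core h.hδ h.hM (hat_fam h.hδ h.hD h.hP h.jb h.hUP) hy ht hs1 hs2
  have hlip := (hat_fam h.hδ h.hD h.hP h.jc h.hUP).lip _ hy t ht (t + a (z + ζ, t))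
    (by simpa using ha1) (t + hat r Ja ((z, ζ), t)) (by simpa using ha2)
  have hL : 2 * (10 / 9 * M₀) / δ ≤ 5 / 9 := by
    rw [div_le_iff₀ h.hδ]; linarith [h.hM]
  rw [add_sub_add_left_eq_sub] at hlip
  have hA := hTa ζ h1 t (h.selfP ht)
  have hB := hTb ζ h2 _ (h.memP ht hs1)
  have hC := hTc ζ h3 _ (h.memP ht ha1)
  have hlip2 : ‖hat r Jc ((z, ζ), t + a (z + ζ, t)) - hat r Jc ((z, ζ), t + hat r Ja ((z, ζ), t))‖
      ≤ 5 / 9 * (Ba * ‖ζ‖ ^ (r + 1)) :=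
    hlip.trans (mul_le_mul hL hA (norm_nonneg _) (by norm_num))
  have hid : (s₁ + hat r Jb ((z, ζ), t + s₁)) - (s₂ + hat r Jb ((z, ζ), t + s₂)) =
      (a (z + ζ, t) - hat r Ja ((z, ζ), t)) +
      (hat r Jc ((z, ζ), t + a (z + ζ, t)) - hat r Jc ((z, ζ), t + hat r Ja ((z, ζ), t))) +
      (c (z + ζ, t + a (z + ζ, t)) - hat r Jc ((z, ζ), t + a (z + ζ, t))) -
      (b (z + ζ, t + s₁) - hat r Jb ((z, ζ), t + s₁)) := by
    rw [heq2]
    have : s₁ = a (z + ζ, t) + c (z + ζ, t + a (z + ζ, t)) - b (z + ζ, t + s₁) := by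
      rw [← heq1]; abel
    nth_rw 1 [this]
    abel
  rw [hid] at hcore
  refine hcore.trans ?_
  have := (norm_sub_le _ _).trans (add_le_add ((norm_add₃_le).trans
    (add_le_add_three hA hlip2 hC)) hB)
  calc _ ≤ 9 / 4 * _ := mul_le_mul_of_nonneg_left this (by norm_num)
    _ = _ := by ring

theorem S_jet (h : Setup r D P U δ M₀ a b c Ja Jb Jc S) {z : E} {t : V} (hz : z ∈ D) (ht : t ∈ U)
    {i : ℕ} (hi : i ≤ r) : iteratedFDeriv ℂ i (fun z => S ((z, 0), t)) z =
      iteratedFDeriv ℂ i (fun ζ => S ((z, ζ), t)) 0 := by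
  obtain ⟨B, ρ, hρ, hρ1, hs, hB⟩ := h.S_close hz
  have d1 : DifferentiableOn ℂ (fun ζ => S ((z + ζ, 0), t)) (ball 0 ρ) :=
    h.slice0.comp (f := fun ζ => (z + ζ, t)) (by fun_prop)
      (fun ζ hζ => ⟨hs (by simpa using hζ), ht⟩)
  have d2 : DifferentiableOn ℂ (fun ζ => S ((z, ζ), t)) (ball 0 ρ) :=
    (h.sliceζ hz ht).mono (ball_subset_ball hρ1)
  have h0 : (0:E) ∈ ball (0:E) ρ := mem_ball_self hρ
  have hv := scv_vanish (f := fun ζ => S ((z + ζ, 0), t) - S ((z, ζ), t)) (k := r + 1) (j := i) hρ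
    (d1.sub d2) (fun ζ hζ => hB ζ (by simpa using hζ) t ht) (Nat.lt_succ_iff.mpr hi)
  have hcd : ∀ {g : E → V}, DifferentiableOn ℂ g (ball 0 ρ) → ContDiffAt ℂ i g 0 := fun hg =>
    (scv_contDiffOn_nat i isOpen_ball hg).contDiffAt (isOpen_ball.mem_nhds h0)
  have := iteratedFDeriv_sub_apply (hcd d1) (hcd d2)
  rw [show (fun ζ => S ((z + ζ, 0), t)) - (fun ζ => S ((z, ζ), t)) =
    fun ζ => S ((z + ζ, 0), t) - S ((z, ζ), t) from rfl, hv] at this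
  have h3 := sub_eq_zero.mp this.symm
  rw [← h3, iteratedFDeriv_comp_add_left (f := fun z => S ((z, 0), t))]
  simp

theorem jet_bd (h : Setup r D P U δ M₀ a b c Ja Jb Jc S) {z : E} {t : V} (hz : z ∈ D) (ht : t ∈ U)
    {i : ℕ} (hi : i ≤ r) : ‖iteratedFDeriv ℂ i (fun z => S ((z, 0), t)) z‖ ≤
      cauchyK i * (9 / 2 * (10 / 9 * M₀) ^ 2 / δ) / (1 / 10) ^ i := by
  rw [h.S_jet hz ht hi]
  exact scv_cauchy i (by norm_num) (h.sliceζ hz ht) (fun ζ hζ =>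
    h.S_bd _ ⟨subset_closure hz, ball_subset_closedBall hζ⟩ t ht)

theorem jet_ext (h : Setup r D P U δ M₀ a b c Ja Jb Jc S) {i : ℕ} (hi : i ≤ r) :
    ∃ g : E × V → ContinuousMultilinearMap ℂ (fun _ : Fin i => E) V,
      ContinuousOn g (closure D ×ˢ U) ∧
      ∀ z ∈ D, ∀ t ∈ U, g (z, t) = iteratedFDeriv ℂ i (fun z => S ((z, 0), t)) z := by
  set G : E × V → ContinuousMultilinearMap ℂ (fun _ : Fin i => E) V := fun p =>
    iteratedFDeriv ℂ i (fun z => S ((z, 0), p.2)) p.1 with hG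
  have hGd : DifferentiableOn ℂ G (D ×ˢ U) := slice_diff h.hD h.hU h.slice0 i
  have hcl : closure D ×ˢ U ⊆ closure (D ×ˢ U) := by
    rw [closure_prod_eq]; exact Set.prod_mono le_rfl subset_closure
  refine ⟨extendFrom (D ×ˢ U) G, continuousOn_extendFrom hcl ?_, ?_⟩
  swap
  · intro z hz t ht
    exact extendFrom_eq (subset_closure ⟨hz, ht⟩) (hGd.continuousOn (z, t) ⟨hz, ht⟩)
  intro p₀ hp₀
  have : (nhdsWithin p₀ (D ×ˢ U)).NeBot := mem_closure_iff_nhdsWithin_neBot.mp (hcl hp₀)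
  apply cauchy_map_iff_exists_tendsto.mp
  rw [Metric.cauchy_iff]
  refine ⟨inferInstance, fun ε hε => ?_⟩
  set κ : ℝ := cauchyK i / (1 / 10) ^ i with hκ
  have hκ0 : 0 < κ := div_pos (cauchyK_pos i) (by positivity)
  set η : ℝ := ε / (4 * κ) with hη
  have hη0 : 0 < η := by positivity
  have hcont : ContinuousOn (Function.uncurry (fun (p : E × V) (ζ : E) => S ((p.1, ζ), p.2)))
      ((closure D ×ˢ U) ×ˢ closedBall (0:E) (1/10)) := by
    have := h.S_cont.comp (f := fun q : (E × V) × E => ((q.1.1, q.2), q.1.2))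
      (s := (closure D ×ˢ U) ×ˢ closedBall (0:E) (1/10)) (by fun_prop)
      (fun q hq => ⟨⟨hq.1.1, hq.2⟩, hq.1.2⟩)
    exact this
  have hcomp : IsCompact (closedBall (0:E) (1/10)) := by
    have := FiniteDimensional.proper ℂ E
    exact isCompact_closedBall _ _
  obtain ⟨v, hv, hvv⟩ := hcomp.mem_uniformity_of_prod hcont hp₀ (Metric.dist_mem_uniformity hη0)
  have hv' : v ∈ nhdsWithin p₀ (D ×ˢ U) :=
    nhdsWithin_mono _ (Set.prod_mono subset_closure le_rfl) hv
  refine ⟨G '' (v ∩ D ×ˢ U), image_mem_map (inter_mem hv' self_mem_nhdsWithin), ?_⟩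
  rintro _ ⟨p, ⟨hpv, hp⟩, rfl⟩ _ ⟨q, ⟨hqv, hq⟩, rfl⟩
  have dp := h.sliceζ hp.1 hp.2
  have dq := h.sliceζ hq.1 hq.2
  have h0 : (0:E) ∈ ball (0:E) (1/10) := mem_ball_self (by norm_num)
  have hcd : ∀ {g : E → V}, DifferentiableOn ℂ g (ball 0 (1/10)) → ContDiffAt ℂ i g 0 := fun hg =>
    (scv_contDiffOn_nat i isOpen_ball hg).contDiffAt (isOpen_ball.mem_nhds h0)
  have hsub := iteratedFDeriv_sub_apply (hcd dp) (hcd dq)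
  have hc := scv_cauchy (f := fun ζ => S ((p.1, ζ), p.2) - S ((q.1, ζ), q.2)) (x := 0) (M := 2 * η)
    (ρ := 1 / 10) i (by norm_num) (dp.sub dq) (fun ζ hζ => by
      have h1 := hvv p hpv ζ (ball_subset_closedBall hζ)
      have h2 := hvv q hqv ζ (ball_subset_closedBall hζ)
      simp only [mem_setOf_eq] at h1 h2
      rw [← dist_eq_norm]
      rw [dist_comm] at h2
      have := dist_triangle (S ((p.1, ζ), p.2)) (S ((p₀.1, ζ), p₀.2)) (S ((q.1, ζ), q.2))
      linarith)
  rw [dist_eq_norm, hG]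
  simp only
  rw [h.S_jet hp.1 hp.2 hi, h.S_jet hq.1 hq.2 hi, ← hsub]
  refine lt_of_le_of_lt hc ?_
  have : cauchyK i * (2 * η) / (1 / 10) ^ i = ε / 2 := by
    rw [show cauchyK i * (2 * η) / (1 / 10) ^ i = κ * (2 * η) by rw [hκ]; ring, hη]
    field_simp; norm_num
  linarith

theorem flat_bd {f : V → V} {M : ℝ} {k : ℕ} (hP : IsOpen P) (h0 : (0:V) ∈ P)
    (hf : DifferentiableOn ℂ f P) (hb : ∀ t ∈ P, ‖f t‖ ≤ M)
    (hv : ∀ j < k + 1, iteratedFDeriv ℂ j f 0 = 0) :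
    ∃ B ρ : ℝ, 0 ≤ B ∧ 0 < ρ ∧ ∀ t, ‖t‖ < ρ → ‖f t‖ ≤ B * ‖t‖ ^ (k + 1) := by
  obtain ⟨ε, hε, hs⟩ := Metric.isOpen_iff.mp hP 0 h0
  have h2 : 2 * (ε / 2) = ε := by ring
  have hM : 0 ≤ M := (norm_nonneg _).trans (hb 0 h0)
  refine ⟨cauchyK (k+1) * M / (ε/2)^(k+1), ε / 2, ?_, by positivity, fun t ht => ?_⟩
  · have := cauchyK_pos (k+1)
    positivity
  have := scv_taylor (f := f) (x := 0) (ρ := ε / 2) (M := M) (by positivity)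
    (by rw [h2]; exact hf.mono hs) (by rw [h2]; exact fun y hy => hb y (hs hy)) k ht
  rw [Finset.sum_eq_zero] at this
  · simpa using this
  · intro i hi
    rw [hv i (Finset.mem_range.mp hi)]; simp

theorem S_vanish (h : Setup r D P U δ M₀ a b c Ja Jb Jc S) (h0 : (0:V) ∈ U) {z : E} (hz : z ∈ D)
    {m₀ : ℕ} (va : ∀ j < m₀, iteratedFDeriv ℂ j (fun t => a (z, t)) 0 = 0)
    (vb : ∀ j < m₀, iteratedFDeriv ℂ j (fun t => b (z, t)) 0 = 0)
    (vc : ∀ j < m₀, iteratedFDeriv ℂ j (fun t => c (z, t)) 0 = 0) :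
    ∀ j < m₀, iteratedFDeriv ℂ j (fun t => S ((z, 0), t)) 0 = 0 := by
  rcases m₀ with _ | k
  · intro j hj; omega
  have hzc := subset_closure hz
  have sl : ∀ {f : E × V → V} {J}, Jet r D P M₀ f J → DifferentiableOn ℂ (fun t => f (z, t)) P :=
    fun hf => hf.diff.comp (by fun_prop) (fun t ht => ⟨hz, ht⟩)
  have bd : ∀ {f : E × V → V} {J}, Jet r D P M₀ f J → ∀ t ∈ P, ‖f (z, t)‖ ≤ 10 / 9 * M₀ := by
    intro f J hf t ht
    rw [← hat_zero hf hzc ht]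
    exact hat_bd hf _ ⟨mem0 hzc, ht⟩
  obtain ⟨Ba, ρa, hBa, hρa, hTa⟩ := flat_bd h.hP (h.selfP h0) (sl h.ja) (bd h.ja) va
  obtain ⟨Bb, ρb, hBb, hρb, hTb⟩ := flat_bd h.hP (h.selfP h0) (sl h.jb) (bd h.jb) vb
  obtain ⟨Bc, ρc, hBc, hρc, hTc⟩ := flat_bd h.hP (h.selfP h0) (sl h.jc) (bd h.jc) vc
  obtain ⟨ε, hε, hs⟩ := Metric.isOpen_iff.mp h.hU 0 h0
  set ρ := min (min ρa ρb) (min (min (ρc / (1 + Ba)) 1) ε) with hρ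
  have hρ0 : 0 < ρ := by positivity
  intro j hj
  refine scv_vanish (ρ := ρ) (B := 9 / 4 * (Ba + Bc * (1 + Ba) ^ (k + 1) + Bb)) (k := k + 1) hρ0
    (h.slice0.comp (f := fun t => (z, t)) (by fun_prop)
      (fun t ht => ⟨hz, hs (ball_subset_ball ((min_le_right _ _).trans (min_le_right _ _)) ht)⟩)) ?_ hj
  intro t ht
  have ht' : ‖t‖ < ρ := by simpa using ht
  rw [hρ, lt_min_iff, lt_min_iff, lt_min_iff, lt_min_iff] at ht'
  obtain ⟨⟨h1, h2⟩, ⟨h3, h4⟩, h5⟩ := ht'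
  have htU : t ∈ U := hs (by simpa using h5)
  obtain ⟨ha1, hs1, heq1⟩ := h.sol0 hzc htU
  have hcore := solver_core h.hδ h.hM (hat_fam h.hδ h.hD h.hP h.jb h.hUP) (mem0 hzc) htU hs1
    (s' := 0) (by simpa using (by linarith [h.hδ] : 0 ≤ 2 * δ / 5))
  rw [hat_zero h.jb hzc (h.memP htU hs1), heq1, add_zero, hat_zero h.jb hzc (h.selfP htU),
    sub_zero, zero_add] at hcore
  have hA := hTa t h1
  have hB := hTb t h2
  have hpow : ‖t‖ ^ (k + 1) ≤ ‖t‖ := by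
    rw [pow_succ]
    exact mul_le_of_le_one_left (norm_nonneg _) (pow_le_one₀ (norm_nonneg _) h4.le)
  have hta : ‖t + a (z, t)‖ ≤ (1 + Ba) * ‖t‖ := by
    refine (norm_add_le _ _).trans ?_
    have : Ba * ‖t‖ ^ (k + 1) ≤ Ba * ‖t‖ := by gcongr
    linarith
  have hta' : ‖t + a (z, t)‖ < ρc := by
    rw [lt_div_iff₀ (by positivity)] at h3
    linarith
  have hC := hTc _ hta'
  have hC' : ‖c (z, t + a (z, t))‖ ≤ Bc * (1 + Ba) ^ (k + 1) * ‖t‖ ^ (k + 1) := by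
    refine hC.trans ?_
    rw [mul_assoc, ← mul_pow]
    gcongr
  refine hcore.trans ?_
  have := (norm_sub_le _ _).trans (add_le_add ((norm_add_le _ _).trans (add_le_add hA hC')) hB)
  calc _ ≤ 9 / 4 * _ := mul_le_mul_of_nonneg_left this (by norm_num)
    _ = _ := by ring

end Setup

end Setup

/-- Postcomposition with the identification of `F` with the `0`-linear maps into `F`. -/
def lift0 {m n : ℕ} (i : ℕ) (L : ContinuousMultilinearMap ℂ (fun _ : Fin i => Cn m) (Cn n)) :
    ContinuousMultilinearMap ℂ (fun _ : Fin i => Cn m)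
      (ContinuousMultilinearMap ℂ (fun _ : Fin 0 => Cn n) (Cn n)) :=
  (continuousMultilinearCurryFin0 ℂ (Cn n) (Cn n)).symm.toLinearIsometry.toContinuousLinearMap.compContinuousMultilinearMap L

theorem lift0_norm {m n : ℕ} (i : ℕ)
    (L : ContinuousMultilinearMap ℂ (fun _ : Fin i => Cn m) (Cn n)) : ‖lift0 i L‖ = ‖L‖ :=
  LinearIsometry.norm_compContinuousMultilinearMap
    (continuousMultilinearCurryFin0 ℂ (Cn n) (Cn n)).symm.toLinearIsometry _

theorem lift0_cont {m n : ℕ} (i : ℕ) : Continuous (lift0 (m := m) (n := n) i) :=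
  (ContinuousLinearMap.compContinuousMultilinearMapL ℂ (fun _ : Fin i => Cn m) (Cn n)
    (ContinuousMultilinearMap ℂ (fun _ : Fin 0 => Cn n) (Cn n))
    (continuousMultilinearCurryFin0 ℂ (Cn n) (Cn n)).symm.toLinearIsometry.toContinuousLinearMap).continuous

/-- Inverse of `lift0`. -/
def drop0 {m n : ℕ} (i : ℕ) (L : ContinuousMultilinearMap ℂ (fun _ : Fin i => Cn m)
      (ContinuousMultilinearMap ℂ (fun _ : Fin 0 => Cn n) (Cn n))) :
    ContinuousMultilinearMap ℂ (fun _ : Fin i => Cn m) (Cn n) :=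
  (continuousMultilinearCurryFin0 ℂ (Cn n) (Cn n)).toLinearIsometry.toContinuousLinearMap.compContinuousMultilinearMap L

theorem drop0_cont {m n : ℕ} (i : ℕ) : Continuous (drop0 (m := m) (n := n) i) :=
  (ContinuousLinearMap.compContinuousMultilinearMapL ℂ (fun _ : Fin i => Cn m)
    (ContinuousMultilinearMap ℂ (fun _ : Fin 0 => Cn n) (Cn n)) (Cn n)
    (continuousMultilinearCurryFin0 ℂ (Cn n) (Cn n)).toLinearIsometry.toContinuousLinearMap).continuous

theorem drop0_lift0 {m n : ℕ} (i : ℕ)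
    (L : ContinuousMultilinearMap ℂ (fun _ : Fin i => Cn m) (Cn n)) : drop0 i (lift0 i L) = L := by
  ext1 v
  exact (continuousMultilinearCurryFin0 ℂ (Cn n) (Cn n)).apply_symm_apply (L v)

theorem pder_zero {m n : ℕ} (i : ℕ) (f : Cn m × Cn n → Cn n) (p : Cn m × Cn n) :
    pder i 0 f p = lift0 i (iteratedFDeriv ℂ i (fun z => f (z, p.2)) p.1) :=
  ContinuousLinearEquiv.iteratedFDeriv_comp_left (f := fun z => f (z, p.2)) (x := p.1)
    (continuousMultilinearCurryFin0 ℂ (Cn n) (Cn n)).symm.toContinuousLinearEquiv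

theorem pder_norm {m n : ℕ} (i : ℕ) (f : Cn m × Cn n → Cn n) (p : Cn m × Cn n) :
    ‖pder i 0 f p‖ = ‖iteratedFDeriv ℂ i (fun z => f (z, p.2)) p.1‖ := by
  rw [pder_zero, lift0_norm]

theorem norm_bdd {m n r : ℕ} {D : Set (Cn m)} {P : Set (Cn n)} {f : Cn m × Cn n → Cn n}
    (hf : ClassArs r 0 D P f) :
    BddAbove {x : ℝ | ∃ i ≤ r, ∃ j ≤ 0, ∃ p ∈ D ×ˢ P, x = ‖pder i j f p‖} := by
  have h1 : ∀ i, ∃ B : ℝ, i ≤ r → ∀ p ∈ D ×ˢ P, ‖pder i 0 f p‖ ≤ B := by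
    intro i
    by_cases hi : i ≤ r
    · obtain ⟨g, _, h2, B, hB⟩ := hf.2.2 i hi 0 le_rfl
      exact ⟨B, fun _ p hp => h2 hp ▸ hB p ⟨subset_closure hp.1, hp.2⟩⟩
    · exact ⟨0, fun h => absurd h hi⟩
  choose B hB using h1
  refine ⟨∑ i ∈ Finset.range (r + 1), |B i|, ?_⟩
  rintro x ⟨i, hi, j, hj, p, hp, rfl⟩
  obtain rfl : j = 0 := Nat.le_zero.mp hj
  refine (hB i hi p hp).trans ((le_abs_self _).trans ?_)
  exact Finset.single_le_sum (f := fun i => |B i|) (fun _ _ => abs_nonneg _)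
    (Finset.mem_range.mpr (Nat.lt_succ_iff.mpr hi))

theorem jet_of_class {m n r : ℕ} {D D' : Set (Cn m)} {P : Set (Cn n)} {f : Cn m × Cn n → Cn n}
    (hf : ClassArs r 0 D P f) (hD' : D' ⊆ D) {M : ℝ} (hM : normCrs r 0 D P f ≤ M) :
    ∃ J, Jet r D' P M f J := by
  have hcl : closure D' ⊆ closure D := closure_mono hD'
  have h1 : ∀ i, ∃ J : Cn m × Cn n → ContinuousMultilinearMap ℂ (fun _ : Fin i => Cn m) (Cn n),
      i ≤ r → ContinuousOn J (closure D' ×ˢ P) ∧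
        ∀ z ∈ D', ∀ t ∈ P, J (z, t) = iteratedFDeriv ℂ i (fun z => f (z, t)) z := by
    intro i
    by_cases hi : i ≤ r
    swap
    · exact ⟨0, fun h => absurd h hi⟩
    obtain ⟨g, h1, h2, _⟩ := hf.2.2 i hi 0 le_rfl
    refine ⟨fun p => drop0 i (g p), fun _ => ⟨?_, ?_⟩⟩
    · exact (drop0_cont i).comp_continuousOn (h1.mono (Set.prod_mono hcl le_rfl))
    · intro z hz t ht
      simp only
      rw [h2 ⟨hD' hz, ht⟩, pder_zero, drop0_lift0]
  choose J hJ using h1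
  have hbd : ∀ i ≤ r, ∀ p ∈ closure D' ×ˢ P, ‖J i p‖ ≤ M := by
    rintro i hi ⟨z, t⟩ ⟨hz, ht⟩
    have hc : ContinuousWithinAt (fun w => J i (w, t)) D' z :=
      ContinuousWithinAt.comp (t := closure D' ×ˢ P) (f := fun w => (w, t))
        ((hJ i hi).1 (z, t) ⟨hz, ht⟩) (by fun_prop)
        (fun w hw => ⟨subset_closure hw, ht⟩)
    refine ContinuousWithinAt.closure_le hz hc.norm continuousWithinAt_const fun w hw => ?_
    rw [(hJ i hi).2 w hw t ht]
    refine le_trans ?_ hM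
    refine le_csSup (norm_bdd hf) ⟨i, hi, 0, le_rfl, (w, t), ⟨hD' hw, ht⟩, ?_⟩
    rw [pder_norm]
  refine ⟨J, ⟨fun i hi => (hJ i hi).1, fun i hi => (hJ i hi).2, hbd, ?_,
    hf.2.1.mono (Set.prod_mono hD' le_rfl)⟩⟩
  rintro ⟨z, t⟩ ⟨hz, ht⟩ v
  have hc1 : ContinuousOn (fun w => J 0 (w, t)) (closure D') :=
    ((hJ 0 (Nat.zero_le _)).1).comp (f := fun w => (w, t)) (by fun_prop) (fun w hw => ⟨hw, ht⟩)
  have hc2 : ContinuousOn (fun w => J 0 (w, t) v) (closure D') :=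
    hc1.eval continuousOn_const
  have hc3 : ContinuousOn (fun w => f (w, t)) (closure D') :=
    hf.1.comp (f := fun w => (w, t)) (by fun_prop) (fun w hw => ⟨hcl hw, ht⟩)
  have : EqOn (fun w => J 0 (w, t) v) (fun w => f (w, t)) (closure D') := by
    refine Set.EqOn.of_subset_closure (s := D') ?_ hc2 hc3 subset_closure le_rfl
    intro w hw
    simp only
    rw [(hJ 0 (Nat.zero_le _)).2 w hw t ht]
    simp
  exact this hz

theorem shrink_closed {n : ℕ} {P : Set (Cn n)} {δ : ℝ} (hδ : 0 < δ) : IsClosed (shrink P δ) := by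
  refine isClosed_of_closure_subset fun t ht => ?_
  have hb : ball t δ ⊆ P := by
    intro y hy
    rw [mem_ball] at hy
    obtain ⟨t', ht', hd⟩ := Metric.mem_closure_iff.mp ht (δ - dist y t) (by linarith)
    refine ht'.2 ?_
    rw [mem_ball]
    linarith [dist_triangle y t t']
  exact ⟨hb (mem_ball_self hδ), hb⟩

/-- The constant of the inductive step. -/
def stepK (r : ℕ) (C : ℝ) : ℝ :=
  ∑ i ∈ Finset.range (r + 1), cauchyK i * 10 ^ i * (9 / 2 * (10 / 9 * C) ^ 2)

theorem stepK_le {r : ℕ} {C : ℝ} {i : ℕ} (hi : i ≤ r) :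
    cauchyK i * 10 ^ i * (9 / 2 * (10 / 9 * C) ^ 2) ≤ stepK r C := by
  unfold stepK
  refine Finset.single_le_sum (f := fun i => cauchyK i * 10 ^ i * (9 / 2 * (10 / 9 * C) ^ 2))
    (fun i _ => ?_) (Finset.mem_range.mpr (Nat.lt_succ_iff.mpr hi))
  have := cauchyK_pos i
  positivity

/-- The inductive step of the generalized Cartan lemma: given a splitting
`c = b - a` with bounds, there is `c̃` on the shrunken parameter set with
`γ ∘ α = β ∘ γ̃` and a quadratic estimate. -/
theorem inductive_step
    (n : ℕ) (hn : 1 ≤ n) (r : ℕ) (C : ℝ) (hC : 1 ≤ C) :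
    ∃ K : ℝ, 0 < K ∧
      ∀ (m : ℕ), 1 ≤ m →
      ∀ (D₀ D₁ : Set (Cn m)), IsOpen D₀ → IsOpen D₁ → Bornology.IsBounded D₀ →
        Bornology.IsBounded D₁ → (D₀ ∩ D₁).Nonempty →
      ∀ (P : Set (Cn n)), IsOpen P → Bornology.IsBounded P →
      ∀ (δ : ℝ), 0 < δ →
      ∀ (c a b : Cn m × Cn n → Cn n),
        ClassArs r 0 (D₀ ∩ D₁) P c →
        ClassArs r 0 D₀ P a → ClassArs r 0 D₁ P b →
        (∀ p ∈ closure (D₀ ∩ D₁) ×ˢ P, c p = b p - a p) →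
        normCrs r 0 D₀ P a ≤ C * normCrs r 0 (D₀ ∩ D₁) P c →
        normCrs r 0 D₁ P b ≤ C * normCrs r 0 (D₀ ∩ D₁) P c →
        4 * Real.sqrt n * C * normCrs r 0 (D₀ ∩ D₁) P c < δ →
        ∀ m₀ : ℕ, TVanish m₀ D₀ a → TVanish m₀ D₁ b → TVanish m₀ (D₀ ∩ D₁) c →
        ∃ ct : Cn m × Cn n → Cn n,
          ClassArs r 0 (D₀ ∩ D₁) (shrink P δ) ct ∧
          (∀ z ∈ closure (D₀ ∩ D₁), ∀ t ∈ shrink P δ,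
            t + a (z, t) ∈ P ∧ t + ct (z, t) ∈ P ∧
            (t + a (z, t)) + c (z, t + a (z, t)) =
              (t + ct (z, t)) + b (z, t + ct (z, t))) ∧
          normCrs r 0 (D₀ ∩ D₁) (shrink P δ) ct ≤
            K * (normCrs r 0 (D₀ ∩ D₁) P c)^2 / δ ∧
          TVanish m₀ (D₀ ∩ D₁) ct := by
  have hK0 : 0 < stepK r C := by
    refine lt_of_lt_of_le ?_ (stepK_le (Nat.zero_le r))
    have := cauchyK_pos 0
    positivity
  refine ⟨stepK r C, hK0, ?_⟩
  intro m _ D₀ D₁ hD₀ hD₁ _ _ _ P hP _ δ hδ c a b hc ha hb habc hna hnb hsm m₀ va vb vc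
  set D := D₀ ∩ D₁ with hDdef
  have hD : IsOpen D := hD₀.inter hD₁
  set N := normCrs r 0 D P c with hN
  have hN0 : 0 ≤ N := by
    refine Real.sSup_nonneg ?_
    rintro x ⟨i, _, j, _, p, _, rfl⟩
    exact norm_nonneg (pder i j c p)
  have hCN : N ≤ C * N := le_mul_of_one_le_left hN0 hC
  have hsm' : 4 * (C * N) < δ := by
    have h1 : (1:ℝ) ≤ Real.sqrt n := Real.one_le_sqrt.mpr (by exact_mod_cast hn)
    have h2 : 0 ≤ C * N := hN0.trans hCN
    nlinarith
  obtain ⟨Ja, ja⟩ := jet_of_class ha (D' := D) inter_subset_left hna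
  obtain ⟨Jb, jb⟩ := jet_of_class hb (D' := D) inter_subset_right hnb
  obtain ⟨Jc, jc⟩ := jet_of_class hc (D' := D) le_rfl hCN
  set W := shrink P δ with hW
  set U := thickening (δ / 10) W with hU
  have hWU : W ⊆ U := self_subset_thickening (by positivity) _
  have hUP : ∀ t ∈ U, ball t (9 * δ / 10) ⊆ P := by
    intro t ht
    obtain ⟨t', ht', hd⟩ := mem_thickening_iff.mp ht
    exact (ball_subset_ball' (by linarith)).trans ht'.2
  have hM : 10 / 9 * (C * N) ≤ 5 / 18 * δ := by linarith
  have hex : ∀ q : (Cn m × Cn m) × Cn n, ∃ s : Cn n,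
      q.1 ∈ closure D ×ˢ closedBall (0 : Cn m) (1/10) → q.2 ∈ U →
        IsSol δ (hat r Ja) (hat r Jb) (hat r Jc) q.1 q.2 s := by
    intro q
    by_cases hq : q.1 ∈ closure D ×ˢ closedBall (0 : Cn m) (1/10) ∧ q.2 ∈ U
    · obtain ⟨s, hs⟩ := solver_exists hδ hM
        (fun t ht => (closedBall_subset_ball (by linarith)).trans (hUP t ht))
        (hat_fam hδ hD hP ja hUP) (hat_fam hδ hD hP jb hUP) (hat_fam hδ hD hP jc hUP)
        (hat_sub hD hP ja jb jc habc) hq.1 hq.2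
      exact ⟨s, fun _ _ => hs⟩
    · exact ⟨0, fun h1 h2 => absurd ⟨h1, h2⟩ hq⟩
  choose S hS using hex
  have h : Setup r D P U δ (C * N) a b c Ja Jb Jc S :=
    ⟨hδ, hD, hP, isOpen_thickening, hUP, hM, ja, jb, jc, habc, fun y hy t ht => hS (y, t) hy ht⟩
  classical
  set ct : Cn m × Cn n → Cn n := fun p =>
    if (0 : Cn n) ∈ W ∨ p.2 ∈ W then S ((p.1, 0), p.2) else 0 with hct
  have hctW : ∀ z, ∀ t ∈ W, ct (z, t) = S ((z, 0), t) := by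
    intro z t ht
    simp [hct, ht]
  have hctd : ∀ i, ∀ t ∈ W, ∀ z, iteratedFDeriv ℂ i (fun z => ct (z, t)) z =
      iteratedFDeriv ℂ i (fun z => S ((z, 0), t)) z := by
    intro i t ht z
    have : (fun z => ct (z, t)) = fun z => S ((z, 0), t) := funext fun z => hctW z t ht
    rw [this]
  have hKb : ∀ i ≤ r, ∀ z ∈ D, ∀ t ∈ U, ‖iteratedFDeriv ℂ i (fun z => S ((z, 0), t)) z‖ ≤
      stepK r C * N ^ 2 / δ := by
    intro i hi z hz t ht
    refine (h.jet_bd hz ht hi).trans ?_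
    have h2 := mul_le_mul_of_nonneg_right (stepK_le (C := C) hi) (show 0 ≤ N ^ 2 / δ by positivity)
    refine le_trans (le_of_eq ?_) (h2.trans (le_of_eq ?_))
    · rw [one_div, inv_pow, div_inv_eq_mul]; ring
    · ring
  refine ⟨ct, ⟨?_, ?_, ?_⟩, ?_, ?_, ?_⟩
  · have h1 : ContinuousOn (fun p : Cn m × Cn n => S ((p.1, 0), p.2)) (closure D ×ˢ W) :=
      h.S_cont.comp (by fun_prop) (fun p hp => ⟨Setup.mem0 hp.1, hWU hp.2⟩)
    exact h1.congr fun p hp => hctW p.1 p.2 hp.2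
  · exact (h.slice0.mono (Set.prod_mono le_rfl hWU)).congr fun p hp => hctW p.1 p.2 hp.2
  · intro i hi j hj
    obtain rfl : j = 0 := Nat.le_zero.mp hj
    obtain ⟨g, hg1, hg2⟩ := h.jet_ext hi
    refine ⟨fun p => lift0 i (g p), ?_, ?_, stepK r C * N ^ 2 / δ, ?_⟩
    · exact (lift0_cont i).comp_continuousOn (hg1.mono (Set.prod_mono le_rfl hWU))
    · intro p hp
      simp only
      rw [pder_zero, hctd i p.2 hp.2, ← hg2 p.1 hp.1 p.2 (hWU hp.2)]
    · rintro ⟨z, t⟩ ⟨hz, ht⟩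
      simp only
      rw [lift0_norm]
      have hcw : ContinuousWithinAt (fun w => g (w, t)) D z :=
        ContinuousWithinAt.comp (t := closure D ×ˢ U) (f := fun w => (w, t))
          (hg1 (z, t) ⟨hz, hWU ht⟩) (by fun_prop) (fun w hw => ⟨subset_closure hw, hWU ht⟩)
      refine ContinuousWithinAt.closure_le hz hcw.norm continuousWithinAt_const fun w hw => ?_
      rw [hg2 w hw t (hWU ht)]
      exact hKb i hi w hw t (hWU ht)
  · intro z hz t ht
    obtain ⟨h1, h2, h3⟩ := h.sol0 hz (hWU ht)
    rw [hctW z t ht]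
    refine ⟨h.memP (hWU ht) h1, h.memP (hWU ht) h2, ?_⟩
    rw [add_assoc, add_assoc, h3]
  · refine Real.sSup_le ?_ (by positivity)
    rintro x ⟨i, hi, j, hj, p, hp, rfl⟩
    obtain rfl : j = 0 := Nat.le_zero.mp hj
    rw [pder_norm, hctd i p.2 hp.2]
    exact hKb i hi p.1 hp.1 p.2 (hWU hp.2)
  · intro j hj z hz
    by_cases h0 : (0 : Cn n) ∈ W
    · have h1 : (fun t => ct (z, t)) = fun t => S ((z, 0), t) := by
        funext t
        simp [hct, h0]
      rw [h1]
      exact h.S_vanish (hWU h0) hz (fun j hj => va j hj z hz.1) (fun j hj => vb j hj z hz.2)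
        (fun j hj => vc j hj z hz) j hj
    · have h1 : (fun t => ct (z, t)) =ᶠ[nhds 0] fun _ => (0 : Cn n) := by
        filter_upwards [(shrink_closed (P := P) hδ).isOpen_compl.mem_nhds h0] with t ht
        have ht' : t ∉ W := ht
        simp [hct, h0, ht']
      rw [(h1.iteratedFDeriv ℂ j).eq_of_nhds]
      exact congrFun iteratedFDeriv_zero_fun 0
end
end

section
/- Let n, m ≥ 1 and r ≥ 0 be integers. There is a constant L > 0, depending only on r and n, with the following property. Let D ⊆ ℂ^m be a bounded open set, P ⊆ ℂ^n an open set, and 0 < δ < 1. Let a₀ ∈ A^{r,0}(D×P)^n and a₁ ∈ A^{r,0}(D×P_{−δ})^n with ‖a₁‖_{C^{r,0}(D×P_{−δ})} < δ/2. Then for every (z,t) ∈ D̄ × P_{−δ} the point t + a₁(z,t) lies in P, the map e(z,t) := a₀(z, t + a₁(z,t)) − a₀(z,t) belongs to A^{r,0}(D×P_{−δ})^n, and ‖e‖_{C^{r,0}(D×P_{−δ})} ≤ (L/δ)·‖a₀‖_{C^{r,0}(D×P)}·‖a₁‖_{C^{r,0}(D×P_{−δ})}. Equivalently, with α_j(z,t)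 := t + a_j(z,t): α₀(z, α₁(z,t)) = t + a₀(z,t) + a₁(z,t) + e(z,t) with this estimate on the error term e. -/
open Set Filter Complex Metric

noncomputable section

open scoped Topology

section Analysis

variable {V F : Type} [NormedAddCommGroup V] [NormedSpace ℂ V]
  [NormedAddCommGroup F] [NormedSpace ℂ F]

/-- Cauchy estimate for the first derivative. -/
theorem cauchy_est {g : V → F} {x : V} {ε M : ℝ} (hε : 0 < ε)
    (hg : DifferentiableOn ℂ g (ball x ε)) (hM : ∀ y ∈ ball x ε, ‖g y‖ ≤ M) :
    ‖fderiv ℂ g x‖ ≤ 2 * M / ε := by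
  have hM0 : 0 ≤ M := (norm_nonneg _).trans (hM x (mem_ball_self hε))
  refine ContinuousLinearMap.opNorm_le_bound _ (by positivity) fun v => ?_
  by_cases hv : v = 0
  · simp [hv]
  have hv' : 0 < ‖v‖ := norm_pos_iff.2 hv
  have hR : 0 < ε / (2 * ‖v‖) := by positivity
  have key : ∀ s ∈ closedBall (0 : ℂ) (ε / (2 * ‖v‖)), x + s • v ∈ ball x ε := by
    intro s hs
    rw [mem_closedBall_zero_iff] at hs
    rw [mem_ball, dist_self_add_left, norm_smul]
    calc ‖s‖ * ‖v‖ ≤ ε / (2 * ‖v‖) * ‖v‖ := by gcongr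
      _ = ε / 2 := by field_simp
      _ < ε := by linarith
  have hd : ∀ s ∈ closedBall (0 : ℂ) (ε / (2 * ‖v‖)),
      DifferentiableAt ℂ (fun s : ℂ => g (x + s • v)) s := by
    intro s hs
    have h1 : DifferentiableAt ℂ g (x + s • v) :=
      hg.differentiableAt (isOpen_ball.mem_nhds (key s hs))
    exact DifferentiableAt.comp (g := g) (f := fun s : ℂ => x + s • v) s h1 (by fun_prop)
  have h2 := Complex.norm_deriv_le_of_forall_mem_sphere_norm_le (c := 0)
    (f := fun s : ℂ => g (x + s • v)) (C := M) hR
    (DifferentiableOn.diffContOnCl (by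
      rw [closure_ball _ hR.ne']
      exact fun s hs => (hd s hs).differentiableWithinAt))
    (fun s hs => hM _ (key s (sphere_subset_closedBall hs)))
  have h3 : HasDerivAt (fun s : ℂ => g (x + s • v)) (fderiv ℂ g x v) 0 := by
    have h4 : HasDerivAt (fun s : ℂ => x + s • v) v 0 := by
      simpa using ((hasDerivAt_id (0 : ℂ)).smul_const v).const_add x
    have h1 : HasFDerivAt g (fderiv ℂ g x) (x + (0 : ℂ) • v) := by
      simpa using (hg.differentiableAt (isOpen_ball.mem_nhds (mem_ball_self hε))).hasFDerivAt
    exact h1.comp_hasDerivAt (0 : ℂ) h4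
  rw [h3.deriv] at h2
  refine h2.trans (le_of_eq ?_)
  field_simp

/-- If a family of holomorphic maps is uniformly Cauchy, so are its derivatives. -/
theorem exists_tendsto_fderiv [CompleteSpace F] {X : Type} {l : Filter X} [l.NeBot]
    {G : X → V → F} {ρ : ℝ} (hρ : 0 < ρ)
    (hd : ∀ᶠ x in l, DifferentiableOn ℂ (G x) (ball 0 ρ))
    (hG : ∀ η > 0, ∃ v ∈ l, ∀ x ∈ v, ∀ x' ∈ v, ∀ w ∈ ball (0 : V) ρ, ‖G x w - G x' w‖ ≤ η) :
    ∃ y, Tendsto (fun x => fderiv ℂ (G x) 0) l (𝓝 y) := by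
  rw [← cauchy_map_iff_exists_tendsto, Metric.cauchy_iff]
  refine ⟨inferInstance, fun η hη => ?_⟩
  obtain ⟨v, hv, hv'⟩ := hG (η * ρ / 4) (by positivity)
  refine ⟨_, image_mem_map (inter_mem hv hd), ?_⟩
  rintro _ ⟨x, ⟨hx, hxd⟩, rfl⟩ _ ⟨x', ⟨hx', hxd'⟩, rfl⟩
  have h0 : ball (0 : V) ρ ∈ 𝓝 0 := ball_mem_nhds _ hρ
  have h1 := cauchy_est hρ (hxd.sub hxd') (M := η * ρ / 4) (fun w hw => hv' x hx x' hx' w hw)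
  rw [fderiv_sub (hxd.differentiableAt h0) (hxd'.differentiableAt h0)] at h1
  rw [dist_eq_norm]
  refine h1.trans_lt ?_
  have : 2 * (η * ρ / 4) / ρ = η / 2 := by field_simp; norm_num
  rw [this]; linarith

variable [FiniteDimensional ℂ V] [CompleteSpace F]

theorem continuousOn_fderiv_of_holo {U : Set V} (hU : IsOpen U) {f : V → F}
    (hf : DifferentiableOn ℂ f U) : ContinuousOn (fderiv ℂ f) U := by
  intro x0 hx0
  have : ProperSpace V := FiniteDimensional.proper ℂ V
  obtain ⟨ε, hε, hεU⟩ := Metric.isOpen_iff.1 hU x0 hx0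
  have hsum : ∀ x ∈ ball x0 (ε / 2), ∀ w ∈ closedBall (0 : V) (ε / 2), x + w ∈ U := by
    intro x hx w hw
    apply hεU
    rw [mem_ball, dist_eq_norm] at hx ⊢
    rw [mem_closedBall_zero_iff] at hw
    calc ‖x + w - x0‖ = ‖(x - x0) + w‖ := by congr 1; abel
      _ ≤ ‖x - x0‖ + ‖w‖ := norm_add_le _ _
      _ < ε := by linarith
  have hball : ball x0 (ε / 2) ∈ 𝓝 x0 := ball_mem_nhds _ (by positivity)
  have := exists_tendsto_fderiv (l := 𝓝 x0) (G := fun x w => f (x + w)) (ρ := ε / 2)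
    (by positivity) (by
      filter_upwards [hball] with x hx w hw
      refine DifferentiableAt.differentiableWithinAt ?_
      exact DifferentiableAt.comp (g := f) (f := fun w => x + w) w
        (hf.differentiableAt (hU.mem_nhds (hsum x hx w (ball_subset_closedBall hw)))) (by fun_prop))
    (by
      intro η hη
      obtain ⟨v, hv, hv'⟩ := IsCompact.mem_uniformity_of_prod (f := fun x w => f (x + w))
        (s := ball x0 (ε / 2)) (q := x0) (isCompact_closedBall (0 : V) (ε / 2))
        (u := {p : F × F | dist p.1 p.2 < η / 2})
        (by
          refine hf.continuousOn.comp (f := fun p : V × V => p.1 + p.2) (by fun_prop) ?_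
          rintro ⟨x, w⟩ ⟨hx, hw⟩
          exact hsum x hx w hw) (mem_ball_self (by positivity)) (Metric.dist_mem_uniformity (by positivity))
      rw [nhdsWithin_eq_nhds.2 hball] at hv
      refine ⟨v, hv, fun x hx x' hx' w hw => ?_⟩
      have h1 := hv' x hx w (ball_subset_closedBall hw)
      have h2 := hv' x' hx' w (ball_subset_closedBall hw)
      simp only [mem_ofPred_eq] at h1 h2
      rw [← dist_eq_norm]
      have := dist_triangle_right (f (x + w)) (f (x' + w)) (f (x0 + w))
      linarith)
  obtain ⟨y, hy⟩ := this
  simp only [fderiv_comp_add_left, add_zero] at hy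
  have : ContinuousAt (fderiv ℂ f) x0 := by
    have hh := hy.mono_left (pure_le_nhds x0)
    have := tendsto_nhds_unique (tendsto_pure_nhds (fderiv ℂ f) x0) hh
    rw [ContinuousAt, this]; exact hy
  exact this.continuousWithinAt

/-- The derivative of a holomorphic map of several variables is holomorphic. -/
theorem differentiableOn_fderiv_of_holo {U : Set V} (hU : IsOpen U) {f : V → F}
    (hf : DifferentiableOn ℂ f U) : DifferentiableOn ℂ (fderiv ℂ f) U := by
  have : ProperSpace V := FiniteDimensional.proper ℂ V
  have hcont := continuousOn_fderiv_of_holo hU hf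
  suffices H : ∀ v, DifferentiableOn ℂ (fun x => fderiv ℂ f x v) U by
    let d := Module.finrank ℂ V
    have hd : d = Module.finrank ℂ (Fin d → ℂ) := (Module.finrank_fin_fun ℂ).symm
    let e₁ : V ≃L[ℂ] Fin d → ℂ := ContinuousLinearEquiv.ofFinrankEq hd
    let e₂ : (V →L[ℂ] F) ≃L[ℂ] (Fin d → F) :=
      (e₁.arrowCongr (1 : F ≃L[ℂ] F)).trans (ContinuousLinearEquiv.piRing (Fin d))
    have h2 : DifferentiableOn ℂ (fun x => e₂ (fderiv ℂ f x)) U :=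
      differentiableOn_pi.2 fun i => H _
    have h3 := e₂.symm.differentiable.comp_differentiableOn h2
    refine h3.congr fun x hx => by simp [Function.comp]
  intro v x0 hx0
  refine DifferentiableAt.differentiableWithinAt ?_
  obtain ⟨ε, hε, hεU⟩ := Metric.isOpen_iff.1 hU x0 hx0
  -- radius
  set R : ℝ := ε / (4 * (‖v‖ + 1)) with hRdef
  have hR : 0 < R := by positivity
  have hsum : ∀ x ∈ closedBall x0 (ε / 4), ∀ s ∈ closedBall (0 : ℂ) R,
      x + s • v ∈ closedBall x0 (ε / 2) := by
    intro x hx s hs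
    rw [mem_closedBall, dist_eq_norm] at hx ⊢
    rw [mem_closedBall_zero_iff] at hs
    have : ‖s • v‖ ≤ ε / 4 := by
      rw [norm_smul]
      calc ‖s‖ * ‖v‖ ≤ R * (‖v‖ + 1) := by gcongr; linarith
        _ = ε / 4 := by rw [hRdef]; field_simp
    calc ‖x + s • v - x0‖ = ‖(x - x0) + s • v‖ := by congr 1; abel
      _ ≤ ‖x - x0‖ + ‖s • v‖ := norm_add_le _ _
      _ ≤ ε / 2 := by linarith
  have hKU : closedBall x0 (ε / 2) ⊆ U :=
    (closedBall_subset_ball (by linarith)).trans hεU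
  obtain ⟨B, hB⟩ := (isCompact_closedBall x0 (ε / 2)).exists_bound_of_continuousOn (hcont.mono hKU)
  have hdat : ∀ y ∈ closedBall x0 (ε / 2), DifferentiableAt ℂ f y := fun y hy =>
    hf.differentiableAt (hU.mem_nhds (hKU hy))
  have hcm : ∀ θ, circleMap 0 R θ ∈ closedBall (0 : ℂ) R := fun θ =>
    circleMap_mem_closedBall 0 hR.le θ
  -- representation
  have hrep : ∀ x ∈ ball x0 (ε / 4), fderiv ℂ f x v =
      (2 * Real.pi * I : ℂ)⁻¹ • ∮ s in C(0, R), (1 / (s - 0) ^ 2) • f (x + s • v) := by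
    intro x hx
    have hx' := ball_subset_closedBall hx
    have h1 : ∀ s ∈ closedBall (0 : ℂ) R, DifferentiableAt ℂ (fun s : ℂ => f (x + s • v)) s :=
      fun s hs => DifferentiableAt.comp (g := f) (f := fun s : ℂ => x + s • v) s
        (hdat _ (hsum x hx' s hs)) (by fun_prop)
    have h2 := DiffContOnCl.deriv_eq_smul_circleIntegral (c := 0)
      (f := fun s : ℂ => f (x + s • v)) hR (DifferentiableOn.diffContOnCl (by
        rw [closure_ball _ hR.ne']
        exact fun s hs => (h1 s hs).differentiableWithinAt))
    have h3 : HasDerivAt (fun s : ℂ => f (x + s • v)) (fderiv ℂ f x v) 0 := by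
      have h4 : HasDerivAt (fun s : ℂ => x + s • v) v 0 := by
        simpa using ((hasDerivAt_id (0 : ℂ)).smul_const v).const_add x
      have h1 : HasFDerivAt f (fderiv ℂ f x) (x + (0 : ℂ) • v) := by
        simpa using (hdat x (closedBall_subset_closedBall (by linarith) hx')).hasFDerivAt
      exact h1.comp_hasDerivAt (0 : ℂ) h4
    rw [h3.deriv] at h2
    rw [h2, inv_smul_smul₀ Complex.two_pi_I_ne_zero]
  have hbm : ball x0 (ε / 4) ∈ 𝓝 x0 := ball_mem_nhds _ (by positivity)
  have hev : (fun x => fderiv ℂ f x v) =ᶠ[𝓝 x0] fun x =>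
      (2 * Real.pi * I : ℂ)⁻¹ • ∮ s in C(0, R), (1 / (s - 0) ^ 2) • f (x + s • v) := by
    filter_upwards [hbm] with x hx using hrep x hx
  refine DifferentiableAt.congr_of_eventuallyEq ?_ hev
  refine DifferentiableAt.const_smul ?_ _
  unfold circleIntegral
  let c : ℝ → ℂ := fun θ => deriv (circleMap 0 R) θ * (1 / (circleMap 0 R θ - 0) ^ 2)
  have hc : Continuous c := by
    have h0 : ∀ θ, circleMap 0 R θ ≠ 0 := fun θ => circleMap_ne_center hR.ne'
    have h1 : Continuous (deriv (circleMap 0 R)) := by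
      rw [show deriv (circleMap 0 R) = fun θ => circleMap 0 R θ * I from by
        ext θ; simp [deriv_circleMap]]
      exact (continuous_circleMap 0 R).mul continuous_const
    refine h1.mul (Continuous.div continuous_const
      (((continuous_circleMap 0 R).sub continuous_const).pow 2) fun θ => ?_)
    simpa using h0 θ
  have hFc : ∀ x ∈ ball x0 (ε / 4), Continuous fun θ : ℝ =>
      deriv (circleMap 0 R) θ • ((1 / (circleMap 0 R θ - 0) ^ 2) • f (x + circleMap 0 R θ • v)) := by
    intro x hx
    have h1 : Continuous fun θ : ℝ => f (x + circleMap 0 R θ • v) := by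
      refine ContinuousOn.comp_continuous (hf.continuousOn.mono hKU)
        (f := fun θ : ℝ => x + circleMap 0 R θ • v) ?_ ?_
      · exact continuous_const.add ((continuous_circleMap 0 R).smul continuous_const)
      · exact fun θ => hsum x (ball_subset_closedBall hx) _ (hcm θ)
    have h5 : Continuous fun θ : ℝ => c θ • f (x + circleMap 0 R θ • v) := hc.smul h1
    simpa [smul_smul, c] using h5
  have hx0b : x0 ∈ ball x0 (ε / 4) := mem_ball_self (by positivity)
  have := intervalIntegral.hasFDerivAt_integral_of_dominated_of_fderiv_le (𝕜 := ℂ)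
    (μ := MeasureTheory.volume) (a := 0) (b := 2 * Real.pi) (x₀ := x0) (s := ball x0 (ε / 4))
    (bound := fun θ => ‖c θ‖ * B)
    (F := fun x θ => deriv (circleMap 0 R) θ •
      ((1 / (circleMap 0 R θ - 0) ^ 2) • f (x + circleMap 0 R θ • v)))
    (F' := fun x θ => c θ • fderiv ℂ f (x + circleMap 0 R θ • v)) hbm
    (by filter_upwards [hbm] with x hx using (hFc x hx).aestronglyMeasurable)
    ((hFc x0 hx0b).intervalIntegrable _ _)
    (by
      refine Continuous.aestronglyMeasurable (hc.smul ?_)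
      refine ContinuousOn.comp_continuous (hcont.mono hKU)
        (f := fun θ : ℝ => x0 + circleMap 0 R θ • v) ?_ ?_
      · exact continuous_const.add ((continuous_circleMap 0 R).smul continuous_const)
      · exact fun θ => hsum x0 (ball_subset_closedBall hx0b) _ (hcm θ))
    (by
      refine Filter.Eventually.of_forall fun θ _ x hx => ?_
      rw [norm_smul]
      gcongr
      exact hB _ (hsum x (ball_subset_closedBall hx) _ (hcm θ)))
    ((hc.norm.mul continuous_const).intervalIntegrable _ _)
    (by
      refine Filter.Eventually.of_forall fun θ _ x hx => ?_
      have h1 := (hdat _ (hsum x (ball_subset_closedBall hx) _ (hcm θ))).hasFDerivAt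
      have h2 : HasFDerivAt (fun x => f (x + circleMap 0 R θ • v))
          (fderiv ℂ f (x + circleMap 0 R θ • v)) x := by
        exact (hasFDerivAt_comp_add_right _).2 h1
      have h3 := h2.const_smul (c θ)
      refine h3.congr_of_eventuallyEq (Filter.Eventually.of_forall fun y => ?_)
      simp only [smul_smul, c, Pi.smul_apply])
  exact this.differentiableAt

end Analysis

section Calculus

set_option linter.unusedSectionVars false

variable {E T F G H : Type} [NormedAddCommGroup E] [NormedSpace ℂ E]
  [NormedAddCommGroup T] [NormedSpace ℂ T]
  [NormedAddCommGroup F] [NormedSpace ℂ F] [NormedAddCommGroup G] [NormedSpace ℂ G]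
  [NormedAddCommGroup H] [NormedSpace ℂ H]

/-- Partial derivative in the first variable. -/
def D1 (u : E × T → F) (p : E × T) : E →L[ℂ] F := fderiv ℂ (fun z => u (z, p.2)) p.1

/-- Partial derivative in the second variable. -/
def D2 (u : E × T → F) (p : E × T) : T →L[ℂ] F := fderiv ℂ (fun t => u (p.1, t)) p.2

/-- `u` has limits at all points of `closure D × S`. -/
def ExtL (D : Set E) (S : Set T) (u : E × T → F) : Prop :=
  ∀ x ∈ closure D ×ˢ S, ∃ y, Tendsto u (𝓝[D ×ˢ S] x) (𝓝 y)

/-- All `z`-derivatives of order at most `r` are bounded by `M` and have limits. -/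
def KB (r : ℕ) (D : Set E) (S : Set T) (u : E × T → F) (M : ℝ) : Prop :=
  (∀ t ∈ S, DifferentiableOn ℂ (fun z => u (z, t)) D) ∧
  ∀ i ≤ r, (∀ p ∈ D ×ˢ S, ‖iteratedFDeriv ℂ i (fun z => u (z, p.2)) p.1‖ ≤ M) ∧
    ExtL D S (fun p => iteratedFDeriv ℂ i (fun z => u (z, p.2)) p.1)

variable {D : Set E} {S : Set T}

theorem ExtL.clm {u : E × T → F} (h : ExtL D S u) (L : F →L[ℂ] G) :
    ExtL D S (fun p => L (u p)) := by
  intro x hx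
  obtain ⟨y, hy⟩ := h x hx
  exact ⟨L y, (L.continuous.tendsto y).comp hy⟩

theorem ExtL.isom_iff (e : F ≃ₗᵢ[ℂ] G) {u : E × T → F} :
    ExtL D S (fun p => e (u p)) ↔ ExtL D S u := by
  constructor
  · intro h
    simpa using ExtL.clm h (e.symm.toContinuousLinearEquiv : G →L[ℂ] F)
  · intro h
    exact ExtL.clm h (e.toContinuousLinearEquiv : F →L[ℂ] G)

theorem ExtL.congr {u v : E × T → F} (h : ExtL D S u) (huv : EqOn u v (D ×ˢ S)) :
    ExtL D S v := by
  intro x hx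
  obtain ⟨y, hy⟩ := h x hx
  refine ⟨y, hy.congr' ?_⟩
  filter_upwards [self_mem_nhdsWithin] with p hp using huv hp

theorem ExtL.mono {S' : Set T} {u : E × T → F} (h : ExtL D S u) (hS : S' ⊆ S) : ExtL D S' u := by
  intro x hx
  obtain ⟨y, hy⟩ := h x ⟨hx.1, hS hx.2⟩
  exact ⟨y, hy.mono_left (nhdsWithin_mono _ (prod_mono_right hS))⟩

theorem ExtL.add {u v : E × T → F} (hu : ExtL D S u) (hv : ExtL D S v) :
    ExtL D S (fun p => u p + v p) := by
  intro x hx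
  obtain ⟨y, hy⟩ := hu x hx
  obtain ⟨y', hy'⟩ := hv x hx
  exact ⟨y + y', hy.add hy'⟩

theorem ExtL.bilin (B : F →L[ℂ] G →L[ℂ] H) {u : E × T → F} {v : E × T → G}
    (hu : ExtL D S u) (hv : ExtL D S v) : ExtL D S (fun p => B (u p) (v p)) := by
  intro x hx
  obtain ⟨y, hy⟩ := hu x hx
  obtain ⟨y', hy'⟩ := hv x hx
  exact ⟨B y y', (B.isBoundedBilinearMap.continuous.tendsto (y, y')).comp (hy.prodMk_nhds hy')⟩

theorem kb_zero {u : E × T → F} {M : ℝ} : KB 0 D S u M ↔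
    (∀ t ∈ S, DifferentiableOn ℂ (fun z => u (z, t)) D) ∧
      (∀ p ∈ D ×ˢ S, ‖u p‖ ≤ M) ∧ ExtL D S u := by
  have h : ∀ p : E × T, iteratedFDeriv ℂ 0 (fun z => u (z, p.2)) p.1 =
      (continuousMultilinearCurryFin0 ℂ E F).symm (u p) := fun p => by
    rw [iteratedFDeriv_zero_eq_comp]; rfl
  unfold KB
  simp only [Nat.le_zero, forall_eq, h, LinearIsometryEquiv.norm_map, ExtL.isom_iff]

theorem KB.le {r s : ℕ} (hrs : s ≤ r) {u : E × T → F} {M : ℝ} (h : KB r D S u M) : KB s D S u M :=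
  ⟨h.1, fun i hi => h.2 i (hi.trans hrs)⟩

theorem KB.bound_mono {r : ℕ} {u : E × T → F} {M N : ℝ} (h : KB r D S u M) (hMN : M ≤ N) :
    KB r D S u N :=
  ⟨h.1, fun i hi => ⟨fun p hp => ((h.2 i hi).1 p hp).trans hMN, (h.2 i hi).2⟩⟩

theorem KB.mono {r : ℕ} {S' : Set T} {u : E × T → F} {M : ℝ} (h : KB r D S u M) (hS : S' ⊆ S) :
    KB r D S' u M :=
  ⟨fun t ht => h.1 t (hS ht), fun i hi =>
    ⟨fun p hp => (h.2 i hi).1 p ⟨hp.1, hS hp.2⟩, (h.2 i hi).2.mono hS⟩⟩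

theorem KB.congr {r : ℕ} {u v : E × T → F} {M : ℝ} (hD : IsOpen D) (h : KB r D S u M)
    (huv : EqOn u v (D ×ˢ S)) : KB r D S v M := by
  have key : ∀ i, ∀ p ∈ D ×ˢ S, iteratedFDeriv ℂ i (fun z => u (z, p.2)) p.1 =
      iteratedFDeriv ℂ i (fun z => v (z, p.2)) p.1 := by
    intro i p hp
    have : (fun z => u (z, p.2)) =ᶠ[𝓝 p.1] (fun z => v (z, p.2)) := by
      filter_upwards [hD.mem_nhds hp.1] with z hz using huv ⟨hz, hp.2⟩
    exact (this.iteratedFDeriv ℂ i).eq_of_nhds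
  refine ⟨fun t ht => (h.1 t ht).congr fun z hz => (huv ⟨hz, ht⟩).symm, fun i hi => ⟨?_, ?_⟩⟩
  · intro p hp
    rw [← key i p hp]
    exact (h.2 i hi).1 p hp
  · exact (h.2 i hi).2.congr (fun p hp => key i p hp)

variable [FiniteDimensional ℂ E]

theorem ext_curry (i : ℕ) (w : E × T → ContinuousMultilinearMap ℂ (fun _ : Fin i => E) (E →L[ℂ] F)) :
    ExtL D S (fun p => (continuousMultilinearCurryRightEquiv' ℂ i E F).symm (w p)) ↔
      ExtL D S w := by
  let e := (continuousMultilinearCurryRightEquiv' ℂ i E F).symm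
  constructor
  · intro h x hx
    obtain ⟨y, hy⟩ := h x hx
    refine ⟨e.symm y, ?_⟩
    have h2 := (e.symm.continuous.tendsto y).comp hy
    refine h2.congr fun p => ?_
    exact e.symm_apply_apply (w p)
  · intro h x hx
    obtain ⟨y, hy⟩ := h x hx
    exact ⟨e y, (e.continuous.tendsto y).comp hy⟩

theorem kb_succ {r : ℕ} [CompleteSpace F] (hD : IsOpen D) {u : E × T → F} {M : ℝ} :
    KB (r + 1) D S u M ↔ KB 0 D S u M ∧ KB r D S (D1 u) M := by
  have key : ∀ i, ∀ p : E × T, iteratedFDeriv ℂ (i + 1) (fun z => u (z, p.2)) p.1 =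
      (continuousMultilinearCurryRightEquiv' ℂ i E F).symm
        (iteratedFDeriv ℂ i (fun z => D1 u (z, p.2)) p.1) := by
    intro i p
    rw [iteratedFDeriv_succ_eq_comp_right]; rfl
  constructor
  · intro h
    refine ⟨h.le (Nat.zero_le _), fun t ht => differentiableOn_fderiv_of_holo hD (h.1 t ht),
      fun i hi => ?_⟩
    have := h.2 (i + 1) (by omega)
    simp only [key, LinearIsometryEquiv.norm_map] at this
    exact ⟨this.1, (ext_curry i _).1 this.2⟩
  · rintro ⟨h0, h1⟩
    refine ⟨h0.1, fun i hi => ?_⟩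
    rcases i with _ | i
    · exact h0.2 0 le_rfl
    · simp only [key, LinearIsometryEquiv.norm_map]
      have h2 := h1.2 i (by omega)
      exact ⟨h2.1, (ext_curry i _).2 h2.2⟩

theorem KB.clm {r : ℕ} [CompleteSpace F] [CompleteSpace G] (hD : IsOpen D) {u : E × T → F} {M : ℝ}
    (h : KB r D S u M) (L : F →L[ℂ] G) (hL : ‖L‖ ≤ 1) : KB r D S (fun p => L (u p)) M := by
  have base : ∀ {F G : Type} [NormedAddCommGroup F] [NormedSpace ℂ F] [NormedAddCommGroup G]
      [NormedSpace ℂ G] {u : E × T → F} (_ : KB 0 D S u M) (L : F →L[ℂ] G) (_ : ‖L‖ ≤ 1),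
      KB 0 D S (fun p => L (u p)) M := by
    intro F G _ _ _ _ u h L hL
    rw [kb_zero] at h ⊢
    refine ⟨fun t ht => L.differentiable.comp_differentiableOn (h.1 t ht), fun p hp => ?_,
      h.2.2.clm L⟩
    calc ‖L (u p)‖ ≤ 1 * ‖u p‖ := L.le_of_opNorm_le hL _
      _ ≤ M := by simpa using h.2.1 p hp
  induction r generalizing F G with
  | zero => exact base h L hL
  | succ r ih =>
    rw [kb_succ hD] at h ⊢
    refine ⟨base h.1 L hL, ?_⟩
    refine (ih h.2 (ContinuousLinearMap.compL ℂ E F G L) ?_).congr hD ?_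
    · refine ContinuousLinearMap.opNorm_le_bound _ zero_le_one fun w => ?_
      exact (ContinuousLinearMap.opNorm_comp_le L w).trans (by gcongr)
    · intro p hp
      have hd : DifferentiableAt ℂ (fun z => u (z, p.2)) p.1 :=
        (h.1.1 p.2 hp.2).differentiableAt (hD.mem_nhds hp.1)
      exact ((L.hasFDerivAt.comp p.1 hd.hasFDerivAt).fderiv).symm

theorem KB.add {r : ℕ} [CompleteSpace F] (hD : IsOpen D) {u v : E × T → F} {M N : ℝ}
    (hu : KB r D S u M) (hv : KB r D S v N) : KB r D S (fun p => u p + v p) (M + N) := by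
  have base : ∀ {F : Type} [NormedAddCommGroup F] [NormedSpace ℂ F]
      {u v : E × T → F} (_ : KB 0 D S u M) (_ : KB 0 D S v N),
      KB 0 D S (fun p => u p + v p) (M + N) := by
    intro F _ _ u v hu hv
    rw [kb_zero] at hu hv ⊢
    refine ⟨fun t ht => (hu.1 t ht).add (hv.1 t ht), fun p hp => ?_, hu.2.2.add hv.2.2⟩
    exact (norm_add_le _ _).trans (add_le_add (hu.2.1 p hp) (hv.2.1 p hp))
  induction r generalizing F with
  | zero => exact base hu hv
  | succ r ih =>
    rw [kb_succ hD] at hu hv ⊢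
    refine ⟨base hu.1 hv.1, (ih hu.2 hv.2).congr hD ?_⟩
    intro p hp
    have hd : DifferentiableAt ℂ (fun z => u (z, p.2)) p.1 :=
      (hu.1.1 p.2 hp.2).differentiableAt (hD.mem_nhds hp.1)
    have hd' : DifferentiableAt ℂ (fun z => v (z, p.2)) p.1 :=
      (hv.1.1 p.2 hp.2).differentiableAt (hD.mem_nhds hp.1)
    exact ((hd.hasFDerivAt.add hd'.hasFDerivAt).fderiv).symm

theorem KB.bilin {r : ℕ} [CompleteSpace F] [CompleteSpace G] [CompleteSpace H] (hD : IsOpen D)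
    (B : F →L[ℂ] G →L[ℂ] H) (hB : ‖B‖ ≤ 1) {u : E × T → F} {v : E × T → G} {M N : ℝ}
    (hM : 0 ≤ M) (hN : 0 ≤ N)
    (hu : KB r D S u M) (hv : KB r D S v N) :
    KB r D S (fun p => B (u p) (v p)) (2 ^ r * (M * N)) := by
  have base : ∀ {F G H : Type} [NormedAddCommGroup F] [NormedSpace ℂ F]
      [NormedAddCommGroup G] [NormedSpace ℂ G] [NormedAddCommGroup H] [NormedSpace ℂ H]
      (B : F →L[ℂ] G →L[ℂ] H) (_ : ‖B‖ ≤ 1)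
      {u : E × T → F} {v : E × T → G} (_ : KB 0 D S u M) (_ : KB 0 D S v N),
      KB 0 D S (fun p => B (u p) (v p)) (M * N) := by
    intro F G H _ _ _ _ _ _ B hB u v hu hv
    rw [kb_zero] at hu hv ⊢
    refine ⟨fun t ht => ?_, fun p hp => ?_, hu.2.2.bilin B hv.2.2⟩
    · exact B.isBoundedBilinearMap.differentiable.comp_differentiableOn
        ((hu.1 t ht).prodMk (hv.1 t ht))
    · calc ‖B (u p) (v p)‖ ≤ ‖B‖ * ‖u p‖ * ‖v p‖ := B.le_opNorm₂ _ _
        _ ≤ 1 * M * N := by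
          gcongr
          · exact hu.2.1 p hp
          · exact hv.2.1 p hp
        _ = M * N := by ring
  induction r generalizing F G H with
  | zero => simpa using base B hB hu hv
  | succ r ih =>
    have hu' := hu.le (Nat.le_succ r)
    have hv' := hv.le (Nat.le_succ r)
    rw [kb_succ hD] at hu hv ⊢
    have hMN : 0 ≤ M * N := mul_nonneg hM hN
    refine ⟨(base B hB hu.1 hv.1).bound_mono ?_, ?_⟩
    · nlinarith [one_le_pow₀ (M₀ := ℝ) (a := 2) (n := r + 1) (by norm_num)]
    have h1 := ih (B.precompR E) ((B.norm_precompR_le E).trans hB) hu' hv.2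
    have h2 := ih (B.precompL E) ((B.norm_precompL_le E).trans hB) hu.2 hv'
    have h3 := (h1.add hD h2).congr hD (v := D1 (fun p => B (u p) (v p))) (by
      intro p hp
      have hd : DifferentiableAt ℂ (fun z => u (z, p.2)) p.1 :=
        (hu.1.1 p.2 hp.2).differentiableAt (hD.mem_nhds hp.1)
      have hd' : DifferentiableAt ℂ (fun z => v (z, p.2)) p.1 :=
        (hv.1.1 p.2 hp.2).differentiableAt (hD.mem_nhds hp.1)
      exact (B.fderiv_of_bilinear hd hd').symm)
    refine h3.bound_mono (le_of_eq (by ring))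

end Calculus

section Holo

set_option linter.unusedSectionVars false

variable {E T F : Type} [NormedAddCommGroup E] [NormedSpace ℂ E] [FiniteDimensional ℂ E]
  [NormedAddCommGroup T] [NormedSpace ℂ T] [FiniteDimensional ℂ T]
  [NormedAddCommGroup F] [NormedSpace ℂ F] [CompleteSpace F]

/-- Jointly holomorphic on `D × P` with bounds and limits for the `z`-derivatives. -/
def KH (r : ℕ) (D : Set E) (P : Set T) (f : E × T → F) (M : ℝ) : Prop :=
  DifferentiableOn ℂ f (D ×ˢ P) ∧ KB r D P f M

variable {D : Set E} {P : Set T}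

theorem hasFDerivAt_slice1 {f : E × T → F} {p : E × T} (h : DifferentiableAt ℂ f p) :
    HasFDerivAt (fun z => f (z, p.2)) ((fderiv ℂ f p).comp (ContinuousLinearMap.inl ℂ E T)) p.1 :=
  HasFDerivAt.comp (g := f) (f := fun z => (z, p.2)) p.1 h.hasFDerivAt
    (hasFDerivAt_prodMk_left p.1 p.2)

theorem hasFDerivAt_slice2 {f : E × T → F} {p : E × T} (h : DifferentiableAt ℂ f p) :
    HasFDerivAt (fun t => f (p.1, t)) ((fderiv ℂ f p).comp (ContinuousLinearMap.inr ℂ E T)) p.2 :=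
  HasFDerivAt.comp (g := f) (f := fun t => (p.1, t)) p.2 h.hasFDerivAt
    (hasFDerivAt_prodMk_right p.1 p.2)

theorem D1_eq {f : E × T → F} {p : E × T} (h : DifferentiableAt ℂ f p) :
    D1 f p = (fderiv ℂ f p).comp (ContinuousLinearMap.inl ℂ E T) :=
  (hasFDerivAt_slice1 h).fderiv

theorem D2_eq {f : E × T → F} {p : E × T} (h : DifferentiableAt ℂ f p) :
    D2 f p = (fderiv ℂ f p).comp (ContinuousLinearMap.inr ℂ E T) :=
  (hasFDerivAt_slice2 h).fderiv

theorem hasFDerivAt_D1 {U : Set (E × T)} (hU : IsOpen U) {f : E × T → F}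
    (hf : DifferentiableOn ℂ f U) {p : E × T} (hp : p ∈ U) :
    HasFDerivAt (D1 f) (((ContinuousLinearMap.compL ℂ E (E × T) F).flip
      (ContinuousLinearMap.inl ℂ E T)).comp (fderiv ℂ (fderiv ℂ f) p)) p := by
  have h1 := ((differentiableOn_fderiv_of_holo hU hf).differentiableAt (hU.mem_nhds hp)).hasFDerivAt
  have h2 := ((ContinuousLinearMap.compL ℂ E (E × T) F).flip
      (ContinuousLinearMap.inl ℂ E T)).hasFDerivAt.comp p h1
  refine h2.congr_of_eventuallyEq ?_
  filter_upwards [hU.mem_nhds hp] with q hq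
  exact D1_eq (hf.differentiableAt (hU.mem_nhds hq))

theorem hasFDerivAt_D2 {U : Set (E × T)} (hU : IsOpen U) {f : E × T → F}
    (hf : DifferentiableOn ℂ f U) {p : E × T} (hp : p ∈ U) :
    HasFDerivAt (D2 f) (((ContinuousLinearMap.compL ℂ T (E × T) F).flip
      (ContinuousLinearMap.inr ℂ E T)).comp (fderiv ℂ (fderiv ℂ f) p)) p := by
  have h1 := ((differentiableOn_fderiv_of_holo hU hf).differentiableAt (hU.mem_nhds hp)).hasFDerivAt
  have h2 := ((ContinuousLinearMap.compL ℂ T (E × T) F).flip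
      (ContinuousLinearMap.inr ℂ E T)).hasFDerivAt.comp p h1
  refine h2.congr_of_eventuallyEq ?_
  filter_upwards [hU.mem_nhds hp] with q hq
  exact D2_eq (hf.differentiableAt (hU.mem_nhds hq))

theorem D1_D2 {U : Set (E × T)} (hU : IsOpen U) {f : E × T → F}
    (hf : DifferentiableOn ℂ f U) {p : E × T} (hp : p ∈ U) :
    D1 (D2 f) p = (D2 (D1 f) p).flip := by
  have h1 := hasFDerivAt_D1 hU hf hp
  have h2 := hasFDerivAt_D2 hU hf hp
  rw [D1_eq h2.differentiableAt, D2_eq h1.differentiableAt, h1.fderiv, h2.fderiv]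
  ext z t
  have h3 := ((differentiableOn_fderiv_of_holo hU hf).differentiableAt (hU.mem_nhds hp)).hasFDerivAt
  have := second_derivative_symmetric_of_eventually (𝕜 := ℂ) (f := f) (f' := fderiv ℂ f) (x := p)
    (by filter_upwards [hU.mem_nhds hp] with q hq using
      (hf.differentiableAt (hU.mem_nhds hq)).hasFDerivAt) h3 (z, 0) (0, t)
  simpa using this

theorem KH.d1 {r : ℕ} (hD : IsOpen D) (hP : IsOpen P) {f : E × T → F} {M : ℝ}
    (h : KH (r + 1) D P f M) : KH r D P (D1 f) M := by
  refine ⟨fun p hp => ?_, ((kb_succ hD).1 h.2).2⟩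
  exact (hasFDerivAt_D1 (hD.prod hP) h.1 hp).differentiableAt.differentiableWithinAt

theorem KH.d2_zero (hD : IsOpen D) (hP : IsOpen P) {Q : Set T} {f : E × T → F}
    {M ε : ℝ} (hε : 0 < ε) (hQP : ∀ t ∈ Q, ball t ε ⊆ P) (h : KH 0 D P f M) :
    KH 0 D Q (D2 f) (2 * M / ε) := by
  have hPT : ProperSpace T := FiniteDimensional.proper ℂ T
  have hsub : Q ⊆ P := fun t ht => hQP t ht (mem_ball_self hε)
  have hd : DifferentiableOn ℂ (D2 f) (D ×ˢ Q) := fun p hp =>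
    (hasFDerivAt_D2 (hD.prod hP) h.1
      ⟨hp.1, hsub hp.2⟩).differentiableAt.differentiableWithinAt
  have hf2 : ∀ p ∈ D ×ˢ P, DifferentiableAt ℂ (fun t => f (p.1, t)) p.2 := fun p hp =>
    (hasFDerivAt_slice2 (h.1.differentiableAt ((hD.prod hP).mem_nhds hp))).differentiableAt
  have hk := kb_zero.1 h.2
  refine ⟨hd, kb_zero.2 ⟨fun t ht => ?_, fun p hp => ?_, ?_⟩⟩
  · intro z hz
    have h1 : DifferentiableAt ℂ (D2 f) (z, t) :=
      (hasFDerivAt_D2 (hD.prod hP) h.1 ⟨hz, hsub ht⟩).differentiableAt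
    exact (hasFDerivAt_slice1 h1).differentiableAt.differentiableWithinAt
  · exact cauchy_est hε (fun t ht => (hf2 (p.1, t) ⟨hp.1, hQP _ hp.2 ht⟩).differentiableWithinAt)
      (fun t ht => hk.2.1 (p.1, t) ⟨hp.1, hQP _ hp.2 ht⟩)
  · rintro ⟨z0, t0⟩ ⟨hz0, ht0⟩
    have hne : (𝓝[D ×ˢ Q] (z0, t0)).NeBot := by
      rw [← mem_closure_iff_nhdsWithin_neBot, closure_prod_eq]
      exact ⟨hz0, subset_closure ht0⟩
    set g := extendFrom (D ×ˢ P) f with hg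
    have hgc : ContinuousOn g (closure D ×ˢ P) := by
      refine continuousOn_extendFrom ?_ hk.2.2
      rw [closure_prod_eq]
      exact prod_mono_right subset_closure
    have hgf : ∀ p ∈ D ×ˢ P, g p = f p := fun p hp =>
      extendFrom_eq (subset_closure hp) (h.1.continuousOn p hp)
    have hsum : ∀ t ∈ ball t0 (ε / 2), ∀ w ∈ closedBall (0 : T) (ε / 2), t + w ∈ P := by
      intro x hx w hw
      apply hQP t0 ht0
      rw [mem_ball, dist_eq_norm] at hx ⊢
      rw [mem_closedBall_zero_iff] at hw
      calc ‖x + w - t0‖ = ‖(x - t0) + w‖ := by congr 1; abel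
        _ ≤ ‖x - t0‖ + ‖w‖ := norm_add_le _ _
        _ < ε := by linarith
    have hnb : {p : E × T | p ∈ D ×ˢ ball t0 (ε / 2)} ∈ 𝓝[D ×ˢ Q] (z0, t0) := by
      have h1 : {p : E × T | p.2 ∈ ball t0 (ε / 2)} ∈ 𝓝[D ×ˢ Q] (z0, t0) := by
        apply mem_nhdsWithin_of_mem_nhds
        exact continuousAt_snd.preimage_mem_nhds (ball_mem_nhds _ (by positivity))
      filter_upwards [h1, self_mem_nhdsWithin] with p hp hp' using ⟨hp'.1, hp⟩
    have := exists_tendsto_fderiv (l := 𝓝[D ×ˢ Q] (z0, t0))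
      (G := fun p w => f (p.1, p.2 + w)) (ρ := ε / 2) (by positivity)
      (by
        filter_upwards [hnb] with p hp w hw
        refine DifferentiableAt.differentiableWithinAt ?_
        exact DifferentiableAt.comp (g := fun t => f (p.1, t)) (f := fun w => p.2 + w) w
          (hf2 (p.1, p.2 + w) ⟨hp.1, hsum p.2 hp.2 w (ball_subset_closedBall hw)⟩) (by fun_prop))
      (by
        intro η hη
        obtain ⟨v, hv, hv'⟩ := IsCompact.mem_uniformity_of_prod
          (f := fun (p : E × T) w => g (p.1, p.2 + w))
          (s := closure D ×ˢ ball t0 (ε / 2)) (q := (z0, t0)) (isCompact_closedBall (0 : T) (ε / 2))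
          (u := {p : F × F | dist p.1 p.2 < η / 2})
          (by
            refine hgc.comp (f := fun p : (E × T) × T => (p.1.1, p.1.2 + p.2)) (by fun_prop) ?_
            rintro ⟨x, w⟩ ⟨hx, hw⟩
            exact ⟨hx.1, hsum x.2 hx.2 w hw⟩) ⟨hz0, mem_ball_self (by positivity)⟩
          (Metric.dist_mem_uniformity (by positivity))
        obtain ⟨o, ho, hov⟩ := mem_nhdsWithin_iff_exists_mem_nhds_inter.1 hv
        refine ⟨o ∩ {p : E × T | p ∈ D ×ˢ ball t0 (ε / 2)},
          inter_mem (mem_nhdsWithin_of_mem_nhds ho) hnb, fun x hx x' hx' w hw => ?_⟩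
        have hw' := ball_subset_closedBall hw
        have h1 := hv' x (hov ⟨hx.1, subset_closure hx.2.1, hx.2.2⟩) w hw'
        have h2 := hv' x' (hov ⟨hx'.1, subset_closure hx'.2.1, hx'.2.2⟩) w hw'
        simp only [mem_ofPred_eq] at h1 h2
        rw [hgf (x.1, x.2 + w) ⟨hx.2.1, hsum _ hx.2.2 w hw'⟩] at h1
        rw [hgf (x'.1, x'.2 + w) ⟨hx'.2.1, hsum _ hx'.2.2 w hw'⟩] at h2
        rw [← dist_eq_norm]
        have := dist_triangle_right (f (x.1, x.2 + w)) (f (x'.1, x'.2 + w)) (g (z0, t0 + w))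
        linarith)
    obtain ⟨y, hy⟩ := this
    refine ⟨y, hy.congr fun p => ?_⟩
    have := fderiv_comp_add_left (𝕜 := ℂ) (f := fun t => f (p.1, t)) (x := 0) p.2
    rw [this, add_zero]
    rfl

theorem KH.d2 {r : ℕ} (hD : IsOpen D) (hP : IsOpen P) {Q : Set T} {f : E × T → F}
    {M ε : ℝ} (hε : 0 < ε) (hQP : ∀ t ∈ Q, ball t ε ⊆ P) (h : KH r D P f M) :
    KH r D Q (D2 f) (2 * M / ε) := by
  induction r generalizing F with
  | zero => exact h.d2_zero hD hP hε hQP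
  | succ r ih =>
    have h0 : KH 0 D P f M := ⟨h.1, h.2.le (Nat.zero_le _)⟩
    have h0' := h0.d2_zero hD hP hε hQP
    refine ⟨h0'.1, (kb_succ hD).2 ⟨h0'.2, ?_⟩⟩
    have h1 := (ih (h.d1 hD hP)).2
    have h2 := KB.clm (G := E →L[ℂ] T →L[ℂ] F) hD h1
      ((ContinuousLinearMap.flipₗᵢ ℂ T E F).toContinuousLinearEquiv :
        (T →L[ℂ] E →L[ℂ] F) →L[ℂ] (E →L[ℂ] T →L[ℂ] F)) (by
        refine ContinuousLinearMap.opNorm_le_bound _ zero_le_one fun w => ?_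
        simp)
    refine h2.congr hD fun p hp => ?_
    exact (D1_D2 (hD.prod hP) h.1 ⟨hp.1, hQP _ hp.2 (mem_ball_self hε)⟩).symm

/-- Chain rule for `z ↦ f (z, t + b (z, t))`. -/
theorem hasFDerivAt_comp_shift {f : E × T → F} {b : E × T → T} {p : E × T}
    (hf : DifferentiableAt ℂ f (p.1, p.2 + b p))
    (hb : DifferentiableAt ℂ (fun z => b (z, p.2)) p.1) :
    HasFDerivAt (fun z => f (z, p.2 + b (z, p.2)))
      (D1 f (p.1, p.2 + b p) + (D2 f (p.1, p.2 + b p)).comp (D1 b p)) p.1 := by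
  have h1 : HasFDerivAt (fun z => (z, p.2 + b (z, p.2)))
      ((ContinuousLinearMap.id ℂ E).prod (D1 b p)) p.1 :=
    (hasFDerivAt_id p.1).prodMk (hb.hasFDerivAt.const_add p.2)
  have h2 := HasFDerivAt.comp (g := f) (f := fun z => (z, p.2 + b (z, p.2))) p.1 hf.hasFDerivAt h1
  refine h2.congr_fderiv ?_
  rw [D1_eq hf, D2_eq hf]
  ext z
  simp [← map_add]

theorem comp_zero (hD : IsOpen D) (hP : IsOpen P) {S : Set T} {f : E × T → F} {b : E × T → T}
    {M N ε : ℝ} (hε : 0 < ε) (hf : KH 0 D P f M) (hb : KB 0 D S b N)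
    (hloc : ∀ p ∈ D ×ˢ S, ball (p.2 + b p) ε ⊆ P) :
    KB 0 D S (fun p => f (p.1, p.2 + b p)) M := by
  have hk := kb_zero.1 hf.2
  have hbk := kb_zero.1 hb
  have hmem : ∀ p ∈ D ×ˢ S, (p.1, p.2 + b p) ∈ D ×ˢ P := fun p hp =>
    ⟨hp.1, hloc p hp (mem_ball_self hε)⟩
  refine kb_zero.2 ⟨fun t ht z hz => ?_, fun p hp => hk.2.1 _ (hmem p hp), ?_⟩
  · have hp : (z, t) ∈ D ×ˢ S := ⟨hz, ht⟩
    exact (hasFDerivAt_comp_shift (p := (z, t))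
      (hf.1.differentiableAt ((hD.prod hP).mem_nhds (hmem _ hp)))
      ((hb.1 t ht).differentiableAt (hD.mem_nhds hz))).differentiableAt.differentiableWithinAt
  · rintro ⟨z0, t0⟩ ⟨hz0, ht0⟩
    have hne : (𝓝[D ×ˢ S] (z0, t0)).NeBot := by
      rw [← mem_closure_iff_nhdsWithin_neBot, closure_prod_eq]
      exact ⟨hz0, subset_closure ht0⟩
    obtain ⟨y, hy⟩ := hbk.2.2 (z0, t0) ⟨hz0, ht0⟩
    have h1 : Tendsto (fun p : E × T => p.1) (𝓝[D ×ˢ S] (z0, t0)) (𝓝 z0) :=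
      continuousAt_fst.tendsto.mono_left nhdsWithin_le_nhds
    have h2 : Tendsto (fun p : E × T => p.2) (𝓝[D ×ˢ S] (z0, t0)) (𝓝 t0) :=
      continuousAt_snd.tendsto.mono_left nhdsWithin_le_nhds
    have h3 := h2.add hy
    have hP0 : t0 + y ∈ P := by
      have := h3.eventually (ball_mem_nhds (t0 + y) hε)
      obtain ⟨p, hp1, hp2⟩ := (this.and self_mem_nhdsWithin).exists
      exact hloc p hp2 (mem_ball_comm.1 hp1)
    obtain ⟨y', hy'⟩ := hk.2.2 (z0, t0 + y) ⟨hz0, hP0⟩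
    refine ⟨y', hy'.comp (tendsto_nhdsWithin_iff.2 ⟨h1.prodMk_nhds h3, ?_⟩)⟩
    filter_upwards [self_mem_nhdsWithin] with p hp using hmem p hp

end Holo

section Estimates

/-- Bound for the composition. -/
theorem comp_bound (r : ℕ) : ∀ c : ℝ, 0 ≤ c → ∃ C : ℝ, 0 ≤ C ∧
    ∀ {E T F : Type} [NormedAddCommGroup E] [NormedSpace ℂ E] [FiniteDimensional ℂ E]
      [NormedAddCommGroup T] [NormedSpace ℂ T] [FiniteDimensional ℂ T]
      [NormedAddCommGroup F] [NormedSpace ℂ F] [CompleteSpace F]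
      {D : Set E} {P S : Set T} (_ : IsOpen D) (_ : IsOpen P) {f : E × T → F} {b : E × T → T}
      {M N ε : ℝ} (_ : 0 < ε) (_ : 0 ≤ M) (_ : 0 ≤ N) (_ : N ≤ c * ε)
      (_ : KH r D P f M) (_ : KB r D S b N) (_ : ∀ p ∈ D ×ˢ S, ball (p.2 + b p) ε ⊆ P),
      KB r D S (fun p => f (p.1, p.2 + b p)) (C * M) := by
  induction r with
  | zero =>
    intro c hc
    refine ⟨1, zero_le_one, ?_⟩
    intro E T F _ _ _ _ _ _ _ _ _ D P S hD hP f b M N ε hε hM hN hNc hf hb hloc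
    rw [one_mul]
    exact comp_zero hD hP hε hf hb hloc
  | succ r ih =>
    intro c hc
    obtain ⟨C1, hC1, H1⟩ := ih c hc
    obtain ⟨C2, hC2, H2⟩ := ih (2 * c) (by positivity)
    refine ⟨1 + C1 + 2 ^ r * 4 * C2 * c, by positivity, ?_⟩
    intro E T F _ _ _ _ _ _ _ _ _ D P S hD hP f b M N ε hε hM hN hNc hf hb hloc
    have hfr : KH r D P f M := ⟨hf.1, hf.2.le (Nat.le_succ r)⟩
    have hbr := hb.le (Nat.le_succ r)
    have hb' := (kb_succ hD).1 hb
    have hz := comp_zero hD hP hε ⟨hf.1, hf.2.le (Nat.zero_le _)⟩ hb'.1 hloc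
    refine (kb_succ hD).2 ⟨hz.bound_mono ?_, ?_⟩
    · have : 0 ≤ C1 + 2 ^ r * 4 * C2 * c := by positivity
      nlinarith
    set Q : Set T := interior {t | ball t (ε / 2) ⊆ P} with hQ
    have hQo : IsOpen Q := isOpen_interior
    have hQP : ∀ t ∈ Q, ball t (ε / 2) ⊆ P := fun t ht => interior_subset ht
    have hlocQ : ∀ p ∈ D ×ˢ S, ball (p.2 + b p) (ε / 2) ⊆ Q := by
      intro p hp
      refine interior_maximal (fun x hx => ?_) isOpen_ball
      refine Subset.trans (ball_subset_ball' ?_) (hloc p hp)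
      have := mem_ball.1 hx
      linarith
    have h1 := H1 hD hP hε hM hN hNc (hf.d1 hD hP) hbr hloc
    have h2 := H2 (S := S) hD hQo (half_pos hε) (by positivity) hN (by linarith)
      (hfr.d2 hD hP (half_pos hε) hQP) hbr hlocQ
    have h3 := KB.bilin hD (ContinuousLinearMap.compL ℂ E T F)
      (ContinuousLinearMap.norm_compL_le ℂ E T F) (by positivity) hN h2 hb'.2
    have h4 := (h1.add hD h3).congr hD (v := D1 fun p => f (p.1, p.2 + b p)) (by
      intro p hp
      exact ((hasFDerivAt_comp_shift (hf.1.differentiableAt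
        ((hD.prod hP).mem_nhds ⟨hp.1, hloc p hp (mem_ball_self hε)⟩))
        ((hb.1 p.2 hp.2).differentiableAt (hD.mem_nhds hp.1))).fderiv).symm)
    refine h4.bound_mono ?_
    have h5 : 2 ^ r * (C2 * (2 * M / (ε / 2)) * N) ≤ 2 ^ r * 4 * C2 * c * M := by
      calc 2 ^ r * (C2 * (2 * M / (ε / 2)) * N) ≤ 2 ^ r * (C2 * (2 * M / (ε / 2)) * (c * ε)) := by
            gcongr
        _ = 2 ^ r * 4 * C2 * c * M := by field_simp; ring
    nlinarith

/-- Bound for the error term. -/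
theorem err_bound (r : ℕ) : ∃ C : ℝ, 0 ≤ C ∧
    ∀ {E T F : Type} [NormedAddCommGroup E] [NormedSpace ℂ E] [FiniteDimensional ℂ E]
      [NormedAddCommGroup T] [NormedSpace ℂ T] [FiniteDimensional ℂ T]
      [NormedAddCommGroup F] [NormedSpace ℂ F] [CompleteSpace F]
      {D : Set E} {P S : Set T} (_ : IsOpen D) (_ : IsOpen P) {f : E × T → F} {b : E × T → T}
      {M N ε : ℝ} (_ : 0 < ε) (_ : 0 ≤ M) (_ : 0 ≤ N) (_ : N ≤ ε)
      (_ : KH r D P f M) (_ : KB r D S b N) (_ : ∀ t ∈ S, ball t (2 * ε) ⊆ P),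
      KB r D S (fun p => f (p.1, p.2 + b p) - f p) (C * (M * N / ε)) := by
  have hlocal : ∀ {E T : Type} [NormedAddCommGroup E] [NormedSpace ℂ E]
      [NormedAddCommGroup T] [NormedSpace ℂ T] {D : Set E} {P S : Set T} {b : E × T → T}
      {N ε : ℝ} (_ : N ≤ ε) (_ : KB 0 D S b N) (_ : ∀ t ∈ S, ball t (2 * ε) ⊆ P),
      ∀ p ∈ D ×ˢ S, ball (p.2 + b p) ε ⊆ P := by
    intro E T _ _ _ _ D P S b N ε hN hb hS p hp
    refine Subset.trans (ball_subset_ball' ?_) (hS p.2 hp.2)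
    have := (kb_zero.1 hb).2.1 p hp
    rw [dist_self_add_left]
    linarith
  have base : ∀ {E T F : Type} [NormedAddCommGroup E] [NormedSpace ℂ E] [FiniteDimensional ℂ E]
      [NormedAddCommGroup T] [NormedSpace ℂ T] [FiniteDimensional ℂ T]
      [NormedAddCommGroup F] [NormedSpace ℂ F] [CompleteSpace F]
      {D : Set E} {P S : Set T} (_ : IsOpen D) (_ : IsOpen P) {f : E × T → F} {b : E × T → T}
      {M N ε : ℝ} (_ : 0 < ε) (_ : 0 ≤ M) (_ : 0 ≤ N) (_ : N ≤ ε)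
      (_ : KH 0 D P f M) (_ : KB 0 D S b N) (_ : ∀ t ∈ S, ball t (2 * ε) ⊆ P),
      KB 0 D S (fun p => f (p.1, p.2 + b p) - f p) (2 * (M * N / ε)) := by
    intro E T F _ _ _ _ _ _ _ _ _ D P S hD hP f b M N ε hε hM hN hNε hf hb hS
    have hSP : S ⊆ P := fun t ht => hS t ht (mem_ball_self (by positivity))
    have h1 := comp_zero hD hP hε hf hb (hlocal hNε hb hS)
    have h2 := (hf.2.mono hSP).clm hD (-ContinuousLinearMap.id ℂ F) (by
      rw [norm_neg]; exact ContinuousLinearMap.norm_id_le)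
    have h3 := kb_zero.1 ((h1.add hD h2).congr hD (v := fun p => f (p.1, p.2 + b p) - f p)
      (fun p hp => by simp [sub_eq_add_neg]))
    refine kb_zero.2 ⟨h3.1, fun p hp => ?_, h3.2.2⟩
    have hball : ∀ t ∈ closedBall p.2 ε, ball t ε ⊆ P := fun t ht =>
      Subset.trans (ball_subset_ball' (by have := mem_closedBall.1 ht; linarith)) (hS p.2 hp.2)
    have hd : ∀ t ∈ P, DifferentiableAt ℂ (fun t => f (p.1, t)) t := fun t ht =>
      (hasFDerivAt_slice2 (p := (p.1, t)) (hf.1.differentiableAt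
        ((hD.prod hP).mem_nhds ⟨hp.1, ht⟩))).differentiableAt
    have hbp := (kb_zero.1 hb).2.1 p hp
    have h4 := (convex_closedBall p.2 ε).norm_image_sub_le_of_norm_fderiv_le (𝕜 := ℂ)
      (f := fun t => f (p.1, t)) (C := 2 * M / ε) (x := p.2) (y := p.2 + b p)
      (fun t ht => hd t (hball t ht (mem_ball_self hε)))
      (fun t ht => cauchy_est hε (fun s hs => (hd s (hball t ht hs)).differentiableWithinAt)
        (fun s hs => (kb_zero.1 hf.2).2.1 (p.1, s) ⟨hp.1, hball t ht hs⟩))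
      (mem_closedBall_self hε.le) (by rw [mem_closedBall, dist_self_add_left]; linarith)
    rw [add_sub_cancel_left] at h4
    calc ‖f (p.1, p.2 + b p) - f p‖ ≤ 2 * M / ε * ‖b p‖ := h4
      _ ≤ 2 * M / ε * N := by gcongr
      _ = 2 * (M * N / ε) := by ring
  induction r with
  | zero => exact ⟨2, by norm_num, base⟩
  | succ r ih =>
    obtain ⟨C0, hC0, H0⟩ := ih
    obtain ⟨C2, hC2, H2⟩ := comp_bound r 2 (by norm_num)
    refine ⟨2 + C0 + 2 ^ r * 4 * C2, by positivity, ?_⟩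
    intro E T F _ _ _ _ _ _ _ _ _ D P S hD hP f b M N ε hε hM hN hNε hf hb hS
    have hfr : KH r D P f M := ⟨hf.1, hf.2.le (Nat.le_succ r)⟩
    have hbr := hb.le (Nat.le_succ r)
    have hb' := (kb_succ hD).1 hb
    have hloc := hlocal hNε hb'.1 hS
    have hz := base hD hP hε hM hN hNε ⟨hf.1, hf.2.le (Nat.zero_le _)⟩ hb'.1 hS
    have hMN : 0 ≤ M * N / ε := by positivity
    refine (kb_succ hD).2 ⟨hz.bound_mono ?_, ?_⟩
    · have : 0 ≤ C0 + 2 ^ r * 4 * C2 := by positivity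
      nlinarith
    set Q : Set T := interior {t | ball t (ε / 2) ⊆ P} with hQ
    have hQo : IsOpen Q := isOpen_interior
    have hQP : ∀ t ∈ Q, ball t (ε / 2) ⊆ P := fun t ht => interior_subset ht
    have hlocQ : ∀ p ∈ D ×ˢ S, ball (p.2 + b p) (ε / 2) ⊆ Q := by
      intro p hp
      refine interior_maximal (fun x hx => ?_) isOpen_ball
      refine Subset.trans (ball_subset_ball' ?_) (hloc p hp)
      have := mem_ball.1 hx
      linarith
    have h1 := H0 hD hP hε hM hN hNε (hf.d1 hD hP) hbr hS
    have h2 := H2 (S := S) hD hQo (half_pos hε) (by positivity) hN (by linarith)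
      (hfr.d2 hD hP (half_pos hε) hQP) hbr hlocQ
    have h3 := KB.bilin hD (ContinuousLinearMap.compL ℂ E T F)
      (ContinuousLinearMap.norm_compL_le ℂ E T F) (by positivity) hN h2 hb'.2
    have h4 := (h1.add hD h3).congr hD (v := D1 fun p => f (p.1, p.2 + b p) - f p) (by
      intro p hp
      have hSP : p.2 ∈ P := hS p.2 hp.2 (mem_ball_self (by positivity))
      have e1 := hasFDerivAt_comp_shift (hf.1.differentiableAt
        ((hD.prod hP).mem_nhds ⟨hp.1, hloc p hp (mem_ball_self hε)⟩))
        ((hb.1 p.2 hp.2).differentiableAt (hD.mem_nhds hp.1))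
      have e2 : HasFDerivAt (fun z => f (z, p.2)) (D1 f p) p.1 :=
        (hasFDerivAt_slice1 (hf.1.differentiableAt
          ((hD.prod hP).mem_nhds ⟨hp.1, hSP⟩))).differentiableAt.hasFDerivAt
      have e3 := (e1.sub e2).fderiv
      refine Eq.trans ?_ e3.symm
      simp only [ContinuousLinearMap.compL_apply]
      abel)
    refine h4.bound_mono ?_
    have h5 : 2 ^ r * (C2 * (2 * M / (ε / 2)) * N) = 2 ^ r * 4 * C2 * (M * N / ε) := by
      field_simp; ring
    rw [h5]
    nlinarith

end Estimates

section Bridge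

variable {m n : ℕ} {F : Type} [NormedAddCommGroup F] [NormedSpace ℂ F] [CompleteSpace F]
  {D : Set (Cn m)} {S : Set (Cn n)} {r : ℕ}

theorem pder_eq (i : ℕ) (f : Cn m × Cn n → F) (p : Cn m × Cn n) :
    pder i 0 f p = iteratedFDeriv ℂ i
      (fun z => (continuousMultilinearCurryFin0 ℂ (Cn n) F).symm (f (z, p.2))) p.1 := by
  unfold pder
  congr 1

theorem kb_curry_iff (hD : IsOpen D) {f : Cn m × Cn n → F} {M : ℝ} :
    KB r D S (fun p => (continuousMultilinearCurryFin0 ℂ (Cn n) F).symm (f p)) M ↔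
      KB r D S f M := by
  constructor
  · intro h
    have h2 := h.clm hD ((continuousMultilinearCurryFin0 ℂ (Cn n) F).toContinuousLinearEquiv :
      _ →L[ℂ] F) (by
        refine ContinuousLinearMap.opNorm_le_bound _ zero_le_one fun w => ?_
        rw [one_mul]
        exact ((continuousMultilinearCurryFin0 ℂ (Cn n) F).norm_map w).le)
    exact h2.congr hD fun p hp => (continuousMultilinearCurryFin0 ℂ (Cn n) F).apply_symm_apply _
  · intro h
    exact KB.clm (G := ContinuousMultilinearMap ℂ (fun _ : Fin 0 => Cn n) F) hD h
      ((continuousMultilinearCurryFin0 ℂ (Cn n) F).symm.toContinuousLinearEquiv :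
        F →L[ℂ] ContinuousMultilinearMap ℂ (fun _ : Fin 0 => Cn n) F) (by
        refine ContinuousLinearMap.opNorm_le_bound _ zero_le_one fun w => ?_
        rw [one_mul]
        exact ((continuousMultilinearCurryFin0 ℂ (Cn n) F).symm.norm_map w).le)

theorem normCrs_nonneg (f : Cn m × Cn n → F) : 0 ≤ normCrs r 0 D S f := by
  refine Real.sSup_nonneg ?_
  rintro x ⟨i, _, j, _, p, _, rfl⟩
  exact norm_nonneg (pder i j f p)

theorem neBot_prod {x : Cn m × Cn n} (hx : x ∈ closure D ×ˢ S) : (𝓝[D ×ˢ S] x).NeBot := by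
  rw [← mem_closure_iff_nhdsWithin_neBot, closure_prod_eq]
  exact ⟨hx.1, subset_closure hx.2⟩

theorem kb_of_class (hD : IsOpen D) {f : Cn m × Cn n → F} (h : ClassArs r 0 D S f) :
    KB r D S f (normCrs r 0 D S f) := by
  obtain ⟨hc, hd, hder⟩ := h
  have hbd : BddAbove {x : ℝ | ∃ i ≤ r, ∃ j ≤ 0, ∃ p ∈ D ×ˢ S, x = ‖pder i j f p‖} := by
    have : ∀ i, ∃ C : ℝ, i ≤ r → ∀ p ∈ D ×ˢ S, ‖pder i 0 f p‖ ≤ C := by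
      intro i
      by_cases hi : i ≤ r
      · obtain ⟨g, -, hg, C, hC⟩ := hder i hi 0 le_rfl
        refine ⟨C, fun _ p hp => ?_⟩
        rw [← hg hp]
        exact hC p ⟨subset_closure hp.1, hp.2⟩
      · exact ⟨0, fun h => absurd h hi⟩
    choose C hC using this
    refine ⟨∑ i ∈ Finset.range (r + 1), |C i|, ?_⟩
    rintro x ⟨i, hi, j, hj, p, hp, rfl⟩
    obtain rfl : j = 0 := Nat.le_zero.1 hj
    refine (hC i hi p hp).trans ((le_abs_self _).trans ?_)
    exact Finset.single_le_sum (f := fun i => |C i|) (fun _ _ => abs_nonneg _)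
      (Finset.mem_range.2 (by omega))
  rw [← kb_curry_iff hD]
  refine ⟨fun t ht => ?_, fun i hi => ?_⟩
  · refine (continuousMultilinearCurryFin0 ℂ (Cn n) F).symm.toContinuousLinearEquiv.differentiable.comp_differentiableOn ?_
    exact hd.comp (f := fun z => (z, t)) (by fun_prop) (fun z hz => ⟨hz, ht⟩)
  · simp only [← pder_eq]
    refine ⟨fun p hp => le_csSup hbd ⟨i, hi, 0, le_rfl, p, hp, rfl⟩, ?_⟩
    obtain ⟨g, hgc, hg, -⟩ := hder i hi 0 le_rfl
    intro x hx
    have h1 := (hgc x hx).tendsto.mono_left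
      (nhdsWithin_mono x (prod_mono_left (t := S) (subset_closure (s := D))))
    refine ⟨g x, h1.congr' ?_⟩
    filter_upwards [self_mem_nhdsWithin] with p hp using hg hp

theorem class_of_kb (hD : IsOpen D) {f : Cn m × Cn n → F} {M : ℝ} (hM : 0 ≤ M)
    (hc : ContinuousOn f (closure D ×ˢ S)) (hd : DifferentiableOn ℂ f (D ×ˢ S))
    (h : KB r D S f M) : ClassArs r 0 D S f ∧ normCrs r 0 D S f ≤ M := by
  rw [← kb_curry_iff hD] at h
  have h2 := h.2
  simp only [← pder_eq] at h2
  refine ⟨⟨hc, hd, fun i hi j hj => ?_⟩, ?_⟩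
  · obtain rfl : j = 0 := Nat.le_zero.1 hj
    obtain ⟨hb, he⟩ := h2 i hi
    have hcl : closure D ×ˢ S ⊆ closure (D ×ˢ S) := by
      rw [closure_prod_eq]
      exact prod_mono_right subset_closure
    refine ⟨extendFrom (D ×ˢ S) (pder i 0 f), continuousOn_extendFrom hcl he, ?_, M, ?_⟩
    · intro p hp
      obtain ⟨y, hy⟩ := he p ⟨subset_closure hp.1, hp.2⟩
      rw [extendFrom_eq (subset_closure hp) hy]
      have h3 := hy.mono_left (pure_le_nhdsWithin hp)
      exact tendsto_nhds_unique h3 (tendsto_pure_nhds _ _)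
    · intro p hp
      obtain ⟨y, hy⟩ := he p hp
      rw [extendFrom_eq (hcl hp) hy]
      have := neBot_prod hp
      refine le_of_tendsto hy.norm ?_
      filter_upwards [self_mem_nhdsWithin] with q hq using hb q hq
  · refine Real.sSup_le ?_ hM
    rintro x ⟨i, hi, j, hj, p, hp, rfl⟩
    obtain rfl : j = 0 := Nat.le_zero.1 hj
    exact (h2 i hi).1 p hp

end Bridge

/-- Estimate for the composition `α₀(z, α₁(z,t)) = t + a₀(z,t) + a₁(z,t) + e(z,t)`:
the error term `e` is of class `A^{r,0}(D×P_{−δ})` with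
`‖e‖ ≤ (L/δ)·‖a₀‖·‖a₁‖`, where `L` depends only on `r` and `n`. -/
theorem composition_estimate
    (n : ℕ) (hn : 1 ≤ n) (r : ℕ) :
    ∃ L : ℝ, 0 < L ∧
      ∀ (m : ℕ), 1 ≤ m →
      ∀ (D : Set (Cn m)), IsOpen D → Bornology.IsBounded D →
      ∀ (P : Set (Cn n)), IsOpen P →
      ∀ (δ : ℝ), 0 < δ → δ < 1 →
      ∀ (a₀ a₁ : Cn m × Cn n → Cn n),
        ClassArs r 0 D P a₀ →
        ClassArs r 0 D (shrink P δ) a₁ →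
        normCrs r 0 D (shrink P δ) a₁ < δ / 2 →
        (∀ z ∈ closure D, ∀ t ∈ shrink P δ, t + a₁ (z, t) ∈ P) ∧
        ClassArs r 0 D (shrink P δ)
          (fun p => a₀ (p.1, p.2 + a₁ p) - a₀ p) ∧
        normCrs r 0 D (shrink P δ) (fun p => a₀ (p.1, p.2 + a₁ p) - a₀ p) ≤
          (L / δ) * normCrs r 0 D P a₀ * normCrs r 0 D (shrink P δ) a₁ := by
  obtain ⟨C, hC, H⟩ := err_bound r
  refine ⟨2 * C + 1, by positivity, ?_⟩
  intro m hm D hD hDb P hP δ hδ hδ1 a₀ a₁ h0 h1 hN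
  have k0 := kb_of_class hD h0
  have k1 := kb_of_class hD h1
  have n0 : 0 ≤ normCrs r 0 D P a₀ := normCrs_nonneg a₀
  have n1 : 0 ≤ normCrs r 0 D (shrink P δ) a₁ := normCrs_nonneg a₁
  set M := normCrs r 0 D P a₀
  set N := normCrs r 0 D (shrink P δ) a₁
  have hb1 : ∀ x ∈ closure D ×ˢ shrink P δ, ‖a₁ x‖ ≤ N := by
    intro x hx
    have := neBot_prod hx
    have h2 := (h1.1 x hx).tendsto.mono_left
      (nhdsWithin_mono x (prod_mono_left (t := shrink P δ) (subset_closure (s := D))))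
    refine le_of_tendsto h2.norm ?_
    filter_upwards [self_mem_nhdsWithin] with q hq
    exact (kb_zero.1 (k1.le (Nat.zero_le r))).2.1 q hq
  have hloc : ∀ z ∈ closure D, ∀ t ∈ shrink P δ, t + a₁ (z, t) ∈ P := by
    intro z hz t ht
    apply ht.2
    have := hb1 (z, t) ⟨hz, ht⟩
    rw [mem_ball, dist_self_add_left]
    linarith
  refine ⟨hloc, ?_⟩
  have hsub : shrink P δ ⊆ P := fun t ht => ht.1
  have hkb := H (S := shrink P δ) hD hP (half_pos hδ) n0 n1 hN.le ⟨h0.2.1, k0⟩ k1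
    (fun t ht => by rw [mul_div_cancel₀ δ two_ne_zero]; exact ht.2)
  have hcont : ContinuousOn (fun p => a₀ (p.1, p.2 + a₁ p) - a₀ p) (closure D ×ˢ shrink P δ) := by
    refine ContinuousOn.sub ?_ (h0.1.mono (prod_mono_right hsub))
    exact h0.1.comp (f := fun p : Cn m × Cn n => (p.1, p.2 + a₁ p))
      (continuousOn_fst.prodMk (continuousOn_snd.add h1.1))
      (fun p hp => ⟨hp.1, hloc p.1 hp.1 p.2 hp.2⟩)
  have hdiff : DifferentiableOn ℂ (fun p => a₀ (p.1, p.2 + a₁ p) - a₀ p) (D ×ˢ shrink P δ) := by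
    refine DifferentiableOn.sub ?_ (h0.2.1.mono (prod_mono_right hsub))
    exact h0.2.1.comp (f := fun p : Cn m × Cn n => (p.1, p.2 + a₁ p))
      (differentiableOn_fst.prodMk (differentiableOn_snd.add h1.2.1))
      (fun p hp => ⟨hp.1, hloc p.1 (subset_closure hp.1) p.2 hp.2⟩)
  obtain ⟨hA, hB⟩ := class_of_kb hD (by positivity) hcont hdiff hkb
  refine ⟨hA, hB.trans ?_⟩
  have e1 : C * (M * N / (δ / 2)) = (2 * C) / δ * M * N := by field_simp
  rw [e1]
  gcongr
  linarith
end
end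

section
/- Let n ≥ 1, let P ⊆ ℂ^n be a bounded convex open set, let δ > 0 and ε > 0 satisfy 4·√n·ε < δ, and let b : P → ℂ^n be holomorphic with ‖b(t)‖ ≤ ε for all t ∈ P. Define β(t) := t + b(t). Then: (1) ‖β(t) − β(t')‖ ≥ (1 − 4·√n·ε/δ)·‖t − t'‖ for all t, t' ∈ P_{−δ/4}; in particular β is injective on P_{−δ/4}; and (2) P_{−δ/2} ⊆ β(P_{−δ/4}), i.e., for every w ∈ P_{−δ/2} there exists t ∈ P_{−δ/4} with t + b(t) = w. -/
open Set Complex Metric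

noncomputable section

theorem cauchy_aux {n : ℕ} {P : Set (Cn n)} {R ε : ℝ} (hR : 0 < R) (hε : 0 < ε)
    (hPopen : IsOpen P)
    {b : Cn n → Cn n} (hb : DifferentiableOn ℂ b P) (hbε : ∀ t ∈ P, ‖b t‖ ≤ ε)
    {t : Cn n} (ht : t ∈ shrink P R) : ‖fderiv ℂ b t‖ ≤ ε / R := by
  refine ContinuousLinearMap.opNorm_le_bound _ (by positivity) fun v => ?_
  rcases eq_or_ne v 0 with rfl | hv
  · simp
  have hv' : 0 < ‖v‖ := norm_pos_iff.2 hv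
  have key : ∀ r, 0 < r → r < R → ‖fderiv ℂ b t v‖ * r ≤ ε * ‖v‖ := by
    intro r hr hrR
    have hmem : ∀ z ∈ closedBall (0 : ℂ) (r / ‖v‖), t + z • v ∈ P := by
      intro z hz
      apply ht.2
      rw [mem_closedBall_zero_iff, le_div_iff₀ hv'] at hz
      rw [mem_ball_iff_norm, add_sub_cancel_left, norm_smul]
      linarith
    have hdt : DifferentiableAt ℂ b t := hb.differentiableAt (hPopen.mem_nhds ht.1)
    have hlin : ∀ z : ℂ, HasDerivAt (fun z : ℂ => t + z • v) v z := by
      intro z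
      simpa using ((hasDerivAt_id z).smul_const v).const_add t
    have hd : HasDerivAt (fun z : ℂ => b (t + z • v)) (fderiv ℂ b t v) 0 := by
      have h1 : HasFDerivAt b (fderiv ℂ b t) (t + (0 : ℂ) • v) := by
        simpa using hdt.hasFDerivAt
      exact h1.comp_hasDerivAt (0 : ℂ) (hlin 0)
    have hdiff : DifferentiableOn ℂ (fun z : ℂ => b (t + z • v)) (closedBall (0 : ℂ) (r / ‖v‖)) :=
      hb.comp (fun z _ => (hlin z).differentiableAt.differentiableWithinAt) hmem
    have hr' : 0 < r / ‖v‖ := by positivity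
    have := Complex.norm_deriv_le_of_forall_mem_sphere_norm_le (C := ε) hr'
      (hdiff.diffContOnCl_ball subset_rfl)
      (fun z hz => hbε _ (hmem z (sphere_subset_closedBall hz)))
    rw [hd.deriv, div_div_eq_mul_div, le_div_iff₀ hr] at this
    exact this
  by_contra! hcon
  have hc : ε * ‖v‖ < ‖fderiv ℂ b t v‖ * R := by
    rw [div_mul_eq_mul_div, div_lt_iff₀ hR] at hcon
    exact hcon
  have ha : 0 < ‖fderiv ℂ b t v‖ := lt_of_le_of_lt (by positivity) hcon
  have h1 : ε * ‖v‖ / ‖fderiv ℂ b t v‖ < R := by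
    rw [div_lt_iff₀ ha]; linarith
  obtain ⟨r, hr1, hr2⟩ := exists_between h1
  have h2 := key r (lt_of_le_of_lt (by positivity) hr1) hr2
  rw [div_lt_iff₀ ha] at hr1
  linarith

theorem shrink_convex_aux {n : ℕ} {P : Set (Cn n)} (hP : Convex ℝ P) {R : ℝ} :
    Convex ℝ (shrink P R) := by
  intro x hx y hy p q hp hq hpq
  refine ⟨hP hx.1 hy.1 hp hq hpq, fun z hz => ?_⟩
  set u := z - (p • x + q • y) with hu
  have hun : ‖u‖ < R := by rwa [mem_ball_iff_norm] at hz
  have h1 : x + u ∈ P := hx.2 (by simpa [mem_ball_iff_norm] using hun)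
  have h2 : y + u ∈ P := hy.2 (by simpa [mem_ball_iff_norm] using hun)
  have h3 := hP h1 h2 hp hq hpq
  have h4 : p • (x + u) + q • (y + u) = z := by
    have : p • u + q • u = u := by rw [← add_smul, hpq, one_smul]
    calc p • (x + u) + q • (y + u) = (p • x + q • y) + (p • u + q • u) := by
          rw [smul_add, smul_add]; abel
      _ = z := by rw [this, hu]; abel
  rwa [h4] at h3

/-- Injectivity and surjectivity of a small holomorphic perturbation
`β(t) = t + b(t)` of the identity: `β` is expanding (hence injective) on
`P_{−δ/4}` and its image covers `P_{−δ/2}`. -/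
theorem perturbed_identity_injective_surjective
    (n : ℕ) (hn : 1 ≤ n) (P : Set (Cn n)) (hPopen : IsOpen P)
    (hPbdd : Bornology.IsBounded P) (hPconv : Convex ℝ P)
    (δ ε : ℝ) (hδ : 0 < δ) (hε : 0 < ε) (hsmall : 4 * Real.sqrt n * ε < δ)
    (b : Cn n → Cn n) (hb : DifferentiableOn ℂ b P) (hbε : ∀ t ∈ P, ‖b t‖ ≤ ε) :
    (∀ t ∈ shrink P (δ / 4), ∀ t' ∈ shrink P (δ / 4),
      (1 - 4 * Real.sqrt n * ε / δ) * ‖t - t'‖ ≤ ‖(t + b t) - (t' + b t')‖) ∧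
    InjOn (fun t => t + b t) (shrink P (δ / 4)) ∧
    shrink P (δ / 2) ⊆ (fun t => t + b t) '' (shrink P (δ / 4)) := by
  have hs1 : 1 ≤ Real.sqrt n := by
    rw [Real.one_le_sqrt]; exact_mod_cast hn
  have hεδ : 4 * ε < δ := by nlinarith
  have hLip : ∀ t ∈ shrink P (δ / 4), ∀ t' ∈ shrink P (δ / 4),
      ‖b t - b t'‖ ≤ ε / (δ / 4) * ‖t - t'‖ := by
    intro t ht t' ht'
    exact (shrink_convex_aux hPconv).norm_image_sub_le_of_norm_fderiv_le (𝕜 := ℂ)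
      (fun x hx => hb.differentiableAt (hPopen.mem_nhds hx.1))
      (fun x hx => cauchy_aux (by positivity) hε hPopen hb hbε hx) ht' ht
  have hexp : ∀ t ∈ shrink P (δ / 4), ∀ t' ∈ shrink P (δ / 4),
      (1 - 4 * Real.sqrt n * ε / δ) * ‖t - t'‖ ≤ ‖(t + b t) - (t' + b t')‖ := by
    intro t ht t' ht'
    have h1 := hLip t ht t' ht'
    have h2 : ε / (δ / 4) ≤ 4 * Real.sqrt n * ε / δ := by
      rw [div_div_eq_mul_div]
      exact div_le_div_of_nonneg_right (by nlinarith) hδ.le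
    have h3 : ‖t - t'‖ ≤ ‖(t + b t) - (t' + b t')‖ + ‖b t - b t'‖ := by
      have : t - t' = ((t + b t) - (t' + b t')) - (b t - b t') := by abel
      calc ‖t - t'‖ = ‖((t + b t) - (t' + b t')) - (b t - b t')‖ := by rw [← this]
        _ ≤ _ := norm_sub_le _ _
    have h4 := mul_le_mul_of_nonneg_right h2 (norm_nonneg (t - t'))
    linarith
  have hpos : 0 < 1 - 4 * Real.sqrt n * ε / δ := by
    rw [sub_pos, div_lt_one hδ]; exact hsmall
  refine ⟨hexp, ?_, ?_⟩
  · intro t ht t' ht' heq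
    have h := hexp t ht t' ht'
    have heq' : t + b t = t' + b t' := heq
    rw [heq', sub_self, norm_zero] at h
    have : ‖t - t'‖ ≤ 0 := by
      by_contra! hc
      have := mul_pos hpos hc
      linarith
    exact sub_eq_zero.1 (norm_le_zero_iff.1 this)
  · intro w hw
    have hsub : closedBall w ε ⊆ shrink P (δ / 4) := by
      intro t ht
      have ht' : dist t w ≤ ε := ht
      refine ⟨hw.2 (mem_ball.2 (by linarith)), fun z hz => hw.2 ?_⟩
      have hz' : dist z t < δ / 4 := hz
      have := dist_triangle z t w
      exact mem_ball.2 (by linarith)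
    have hmaps : MapsTo (fun t => w - b t) (closedBall w ε) (closedBall w ε) := by
      intro t ht
      rw [mem_closedBall_iff_norm]
      simpa using hbε t (hsub ht).1
    have hK : ContractingWith (Real.toNNReal (ε / (δ / 4)))
        (hmaps.restrict (fun t => w - b t) (closedBall w ε) (closedBall w ε)) := by
      refine ⟨?_, LipschitzWith.of_dist_le_mul fun x y => ?_⟩
      · rw [Real.toNNReal_lt_one, div_lt_one (by positivity)]
        linarith
      · rw [Real.coe_toNNReal _ (by positivity), Subtype.dist_eq, Subtype.dist_eq]
        have := hLip x (hsub x.2) y (hsub y.2)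
        simpa [dist_eq_norm, norm_sub_rev] using this
    obtain ⟨y, hy, hfix, -⟩ := hK.exists_fixedPoint' isClosed_closedBall.isComplete hmaps
      (mem_closedBall_self hε.le) (edist_ne_top _ _)
    refine ⟨y, hsub hy, ?_⟩
    have : w - b y = y := hfix
    change y + b y = w
    exact (sub_eq_iff_eq_add.1 this).symm
end
end
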